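/- arXiv:2102.07141 — 2 statements merged into one kernel-verified Lean document; each statement's English description precedes it below -/
import Mathlib

section
/- Let D = {x' ∈ ℝ^{N−1} : R₀ < |x'| < R₁}, identified with A ∩ {x_N = 0} and equipped with (N−1)-dimensional Lebesgue measure. For every q ≥ 1 there exists a constant C₁(q) > 0, depending only on q, N, R₀, R₁, such that (∫_D |u(x',0)|^q dx')^{1/q} ≤ C₁(q) (∫_A (|∇u|² + u²) dx)^{1/2} for every u ∈ K. -/
open MeasureTheory Real Set

noncomputable section

/-- The open annulus `{x : R₀ < |x| < R₁}` in `ℝ^N`. -/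
def annulus (N : ℕ) (R₀ R₁ : ℝ) : Set (EuclideanSpace ℝ (Fin N)) :=
  {x | R₀ < ‖x‖ ∧ ‖x‖ < R₁}

/-- The last coordinate `x_N` of a point of `ℝ^N`. -/
def lastCoord {N : ℕ} (x : EuclideanSpace ℝ (Fin N)) : ℝ :=
  if h : 0 < N then x ⟨N - 1, by omega⟩ else 0

/-- The polar angle `θ = arcsin (x_N / |x|)`. -/
def angleOf {N : ℕ} (x : EuclideanSpace ℝ (Fin N)) : ℝ :=
  Real.arcsin (lastCoord x / ‖x‖)

/-- `u` is axially symmetric on the closed annulus with representative `𝔲 = 𝔲(r,θ)`. -/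
def IsAxiallySymmRep (N : ℕ) (R₀ R₁ : ℝ) (u : EuclideanSpace ℝ (Fin N) → ℝ)
    (𝔲 : ℝ → ℝ → ℝ) : Prop :=
  ∀ x ∈ closure (annulus N R₀ R₁), u x = 𝔲 ‖x‖ (angleOf x)

/-- Membership in the cone `K̂`: `C¹` on the closed annulus, nonnegative, axially symmetric,
even in `θ` and nonincreasing in `θ` on `[0, π/2]`. -/
def memKhat (N : ℕ) (R₀ R₁ : ℝ) (u : EuclideanSpace ℝ (Fin N) → ℝ) : Prop :=
  ContDiffOn ℝ 1 u (closure (annulus N R₀ R₁)) ∧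
  (∀ x ∈ closure (annulus N R₀ R₁), 0 ≤ u x) ∧
  ∃ 𝔲 : ℝ → ℝ → ℝ,
    IsAxiallySymmRep N R₀ R₁ u 𝔲 ∧
    (∀ r ∈ Icc R₀ R₁, ∀ θ ∈ Icc (-(π / 2)) (π / 2), 𝔲 r (-θ) = 𝔲 r θ) ∧
    (∀ r ∈ Icc R₀ R₁, AntitoneOn (𝔲 r) (Icc 0 (π / 2)))

/-- `C¹₀(A)` : `C¹` on the closed annulus, vanishing on the boundary. -/
def memC10 (N : ℕ) (R₀ R₁ : ℝ) (u : EuclideanSpace ℝ (Fin N) → ℝ) : Prop :=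
  ContDiffOn ℝ 1 u (closure (annulus N R₀ R₁)) ∧
  ∀ x : EuclideanSpace ℝ (Fin N), (‖x‖ = R₀ ∨ ‖x‖ = R₁) → u x = 0

/-- The cone `K = K̂ ∩ C¹₀(A)`. -/
def memK (N : ℕ) (R₀ R₁ : ℝ) (u : EuclideanSpace ℝ (Fin N) → ℝ) : Prop :=
  memKhat N R₀ R₁ u ∧ ∀ x : EuclideanSpace ℝ (Fin N), (‖x‖ = R₀ ∨ ‖x‖ = R₁) → u x = 0

/-- The squared `H¹(A)`-norm `∫_A (|∇u|² + u²) dx`. -/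
def H1sq (N : ℕ) (R₀ R₁ : ℝ) (u : EuclideanSpace ℝ (Fin N) → ℝ) : ℝ :=
  ∫ x in annulus N R₀ R₁,
    (‖fderivWithin ℝ u (closure (annulus N R₀ R₁)) x‖ ^ 2 + (u x) ^ 2)

/-- The energy functional `I(u) = ½‖u‖²_{H¹} − (1/p) ∫_A a |u|^p`. -/
def funcI (N : ℕ) (R₀ R₁ : ℝ) (a : EuclideanSpace ℝ (Fin N) → ℝ) (p : ℝ)
    (u : EuclideanSpace ℝ (Fin N) → ℝ) : ℝ :=
  (1 / 2) * H1sq N R₀ R₁ u - (1 / p) * ∫ x in annulus N R₀ R₁, a x * |u x| ^ p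

/-- The Nehari set `N_K`. -/
def memNehari (N : ℕ) (R₀ R₁ : ℝ) (a : EuclideanSpace ℝ (Fin N) → ℝ) (p : ℝ)
    (u : EuclideanSpace ℝ (Fin N) → ℝ) : Prop :=
  memK N R₀ R₁ u ∧ (∃ x ∈ annulus N R₀ R₁, u x ≠ 0) ∧
  H1sq N R₀ R₁ u = ∫ x in annulus N R₀ R₁, a x * |u x| ^ p

/-- The Nehari level `c_I = inf_{N_K} I`. -/
def cI (N : ℕ) (R₀ R₁ : ℝ) (a : EuclideanSpace ℝ (Fin N) → ℝ) (p : ℝ) : ℝ :=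
  sInf {c | ∃ u, memNehari N R₀ R₁ a p u ∧ c = funcI N R₀ R₁ a p u}

/-- Test functions `C_c^∞(A)`. -/
def IsTestFun (N : ℕ) (R₀ R₁ : ℝ) (φ : EuclideanSpace ℝ (Fin N) → ℝ) : Prop :=
  ContDiff ℝ (⊤ : ℕ∞) φ ∧ HasCompactSupport φ ∧ tsupport φ ⊆ annulus N R₀ R₁

/-- Weak solution of `−Δu + u = a(x)|u|^{p−2}u` in `A`, `u = 0` on `∂A`. -/
def IsWeakSolution (N : ℕ) (R₀ R₁ : ℝ) (a : EuclideanSpace ℝ (Fin N) → ℝ) (p : ℝ)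
    (u : EuclideanSpace ℝ (Fin N) → ℝ) : Prop :=
  memC10 N R₀ R₁ u ∧
  ∀ φ : EuclideanSpace ℝ (Fin N) → ℝ, IsTestFun N R₀ R₁ φ →
    (∫ x in annulus N R₀ R₁,
      (fderivWithin ℝ u (closure (annulus N R₀ R₁)) x (gradient φ x) + u x * φ x))
    = ∫ x in annulus N R₀ R₁, a x * |u x| ^ (p - 2) * u x * φ x

/-- The (classical) Laplacian, as the sum of second partial derivatives. -/
def lapl {N : ℕ} (u : EuclideanSpace ℝ (Fin N) → ℝ) (x : EuclideanSpace ℝ (Fin N)) : ℝ :=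
  ∑ i : Fin N,
    fderiv ℝ (fun y => fderiv ℝ u y (EuclideanSpace.single i 1)) x (EuclideanSpace.single i 1)

/-- The inclusion `ℝ^{N-1} → ℝ^N`, `x' ↦ (x',0)`. -/
def embedHyper (N : ℕ) (x' : EuclideanSpace ℝ (Fin (N - 1))) : EuclideanSpace ℝ (Fin N) :=
  (WithLp.equiv 2 (Fin N → ℝ)).symm
    (fun j => if h : (j : ℕ) < N - 1 then x' ⟨j, h⟩ else 0)

/-- A `C¹` distance on the closed annulus. -/
def C1dist (N : ℕ) (R₀ R₁ : ℝ) (u v : EuclideanSpace ℝ (Fin N) → ℝ) : ℝ :=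
  (⨆ x : closure (annulus N R₀ R₁), |u x - v x|) +
  (⨆ x : closure (annulus N R₀ R₁),
    ‖fderivWithin ℝ u (closure (annulus N R₀ R₁)) x
      - fderivWithin ℝ v (closure (annulus N R₀ R₁)) x‖)

end


open scoped ENNReal

theorem s6_lintegral_fun_norm {E : Type*} [NormedAddCommGroup E] [NormedSpace ℝ E]
    [FiniteDimensional ℝ E] [Nontrivial E] [MeasurableSpace E] [BorelSpace E]
    (μ : Measure E) [μ.IsAddHaarMeasure] (f : ℝ → ℝ≥0∞) (hf : Measurable f) :
    ∫⁻ x, f ‖x‖ ∂μ = μ.toSphere univ *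
      ∫⁻ r in Ioi (0 : ℝ), ENNReal.ofReal (r ^ (Module.finrank ℝ E - 1)) * f r := by
  calc ∫⁻ x, f ‖x‖ ∂μ = ∫⁻ x : ({(0 : E)}ᶜ : Set E), f ‖x.1‖ ∂(μ.comap (↑)) := by
        rw [lintegral_subtype_comap (measurableSet_singleton _).compl fun x ↦ f (‖x‖),
          restrict_compl_singleton]
    _ = ∫⁻ z, f (z.2 : ℝ) ∂(μ.toSphere.prod (Measure.volumeIoiPow (Module.finrank ℝ E - 1))) := by
        have := (μ.measurePreserving_homeomorphUnitSphereProd).lintegral_comp_emb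
          (Homeomorph.measurableEmbedding _) (fun z => f (z.2 : ℝ))
        rw [← this]
        simp
    _ = μ.toSphere univ * ∫⁻ r, f (r : ℝ) ∂(Measure.volumeIoiPow (Module.finrank ℝ E - 1)) := by
        have := lintegral_prod_mul (μ := μ.toSphere)
          (ν := Measure.volumeIoiPow (Module.finrank ℝ E - 1)) (f := fun _ => 1)
          (g := fun r => f (r : ℝ)) aemeasurable_const
          (hf.comp measurable_subtype_coe).aemeasurable
        simpa using this
    _ = _ := by
        congr 1
        rw [Measure.volumeIoiPow, lintegral_withDensity_eq_lintegral_mul _ (by fun_prop)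
          (g := fun r : Ioi (0 : ℝ) => f r) (hf.comp measurable_subtype_coe)]
        simp only [Pi.mul_apply]
        rw [lintegral_subtype_comap measurableSet_Ioi
          (fun r : ℝ => ENNReal.ofReal (r ^ (Module.finrank ℝ E - 1)) * f r)]

theorem s6_cs {α : Type*} [MeasurableSpace α] (μ : Measure α) (f g : α → ℝ≥0∞)
    (hf : AEMeasurable f μ) (hg : AEMeasurable g μ) :
    (∫⁻ x, f x * g x ∂μ) ^ 2 ≤ (∫⁻ x, f x ^ 2 ∂μ) * ∫⁻ x, g x ^ 2 ∂μ := by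
  have h := ENNReal.lintegral_mul_le_Lp_mul_Lq μ Real.HolderConjugate.two_two hf hg
  simp only [ENNReal.rpow_ofNat, Pi.mul_apply] at h
  calc _ ≤ _ := pow_le_pow_left' h 2
    _ = _ := by
      rw [mul_pow, ← ENNReal.rpow_natCast, ← ENNReal.rpow_natCast, ← ENNReal.rpow_mul,
        ← ENNReal.rpow_mul]
      norm_num

theorem s6_lady (w G : ℝ → ℝ → ℝ≥0∞) (hw : Measurable (Function.uncurry w))
    (hG : Measurable (Function.uncurry G)) (Q : Set (ℝ × ℝ)) (hQ : MeasurableSet Q)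
    (hG0 : ∀ a b, (a, b) ∉ Q → G a b = 0)
    (h1 : ∀ (k : ℕ) a b, w a b ^ (k + 1) ≤ ((k + 1 : ℕ) : ℝ≥0∞) * ∫⁻ s, w s b ^ k * G s b)
    (h2 : ∀ (k : ℕ) a b, w a b ^ (k + 1) ≤ ((k + 1 : ℕ) : ℝ≥0∞) * ∫⁻ s, w a s ^ k * G a s)
    (k : ℕ) (b : ℝ) :
    (∫⁻ a, w a b ^ (k + 1)) ^ 2 ≤ ((k + 1).factorial : ℝ≥0∞) ^ 2 * volume Q *
      (∫⁻ z : ℝ × ℝ, G z.1 z.2 ^ 2) ^ (k + 1) := by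
  set E := ∫⁻ z : ℝ × ℝ, G z.1 z.2 ^ 2 with hE
  have hw' : Measurable fun z : ℝ × ℝ => w z.1 z.2 := hw
  have hG' : Measurable fun z : ℝ × ℝ => G z.1 z.2 := hG
  have hm : ∀ k : ℕ, Measurable fun z : ℝ × ℝ => w z.1 z.2 ^ k * G z.1 z.2 := fun k =>
    (hw'.pow_const k).mul hG'
  have hB1 : ∀ k : ℕ, ∫⁻ a, ∫⁻ s, w a s ^ k * G a s = ∫⁻ z : ℝ × ℝ, w z.1 z.2 ^ k * G z.1 z.2 := by
    intro k
    rw [Measure.volume_eq_prod, lintegral_prod _ (hm k).aemeasurable]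
  have hB2 : ∀ k : ℕ, ∫⁻ t, ∫⁻ s, w s t ^ k * G s t = ∫⁻ z : ℝ × ℝ, w z.1 z.2 ^ k * G z.1 z.2 := by
    intro k
    rw [Measure.volume_eq_prod, lintegral_prod_symm _ (hm k).aemeasurable]
  have hB : ∀ k : ℕ, (∫⁻ z : ℝ × ℝ, w z.1 z.2 ^ k * G z.1 z.2) ^ 2 ≤
      (∫⁻ z in Q, w z.1 z.2 ^ (2 * k)) * E := by
    intro k
    have e1 : ∫⁻ z : ℝ × ℝ, w z.1 z.2 ^ k * G z.1 z.2 = ∫⁻ z in Q, w z.1 z.2 ^ k * G z.1 z.2 := by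
      rw [← lintegral_indicator hQ]
      congr 1
      ext z
      by_cases hz : z ∈ Q
      · simp [hz]
      · simp [hz, hG0 z.1 z.2 hz]
    rw [e1]
    refine (s6_cs _ _ _ (hw'.pow_const k).aemeasurable hG'.aemeasurable).trans ?_
    refine mul_le_mul' ?_ ?_
    · apply le_of_eq
      congr 1
      funext z
      rw [← pow_mul, mul_comm]
    · exact setLIntegral_le_lintegral _ _
  have hA : ∀ k : ℕ, ∫⁻ z in Q, w z.1 z.2 ^ (2 * k) ≤
      ((k.factorial : ℕ) : ℝ≥0∞) ^ 2 * volume Q * E ^ k := by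
    intro k
    induction k with
    | zero => simp
    | succ k ih =>
      calc ∫⁻ z in Q, w z.1 z.2 ^ (2 * (k + 1)) ≤ ∫⁻ z : ℝ × ℝ, w z.1 z.2 ^ (2 * (k + 1)) :=
            setLIntegral_le_lintegral _ _
        _ ≤ ∫⁻ z : ℝ × ℝ, (((k + 1 : ℕ) : ℝ≥0∞) * ∫⁻ s, w z.1 s ^ k * G z.1 s) *
              (((k + 1 : ℕ) : ℝ≥0∞) * ∫⁻ s, w s z.2 ^ k * G s z.2) := by
            apply lintegral_mono
            intro z
            simp only
            rw [two_mul, pow_add]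
            exact mul_le_mul' (h2 k z.1 z.2) (h1 k z.1 z.2)
        _ = (((k + 1 : ℕ) : ℝ≥0∞) * ∫⁻ z : ℝ × ℝ, w z.1 z.2 ^ k * G z.1 z.2) ^ 2 := by
            rw [Measure.volume_eq_prod, lintegral_prod_mul
              (f := fun a => ((k + 1 : ℕ) : ℝ≥0∞) * ∫⁻ s, w a s ^ k * G a s)
              (g := fun b => ((k + 1 : ℕ) : ℝ≥0∞) * ∫⁻ s, w s b ^ k * G s b)]
            · rw [lintegral_const_mul, lintegral_const_mul, hB1, hB2, sq, ← Measure.volume_eq_prod]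
              · exact (hm k).lintegral_prod_left'
              · exact (hm k).lintegral_prod_right'
            · exact ((hm k).lintegral_prod_right'.const_mul _).aemeasurable
            · exact ((hm k).lintegral_prod_left'.const_mul _).aemeasurable
        _ ≤ ((k + 1 : ℕ) : ℝ≥0∞) ^ 2 * ((((k.factorial : ℕ) : ℝ≥0∞) ^ 2 * volume Q * E ^ k) * E) := by
            rw [mul_pow]
            gcongr
            exact (hB k).trans (by gcongr)
        _ = _ := by
            rw [Nat.factorial_succ]
            push_cast
            ring
  calc (∫⁻ a, w a b ^ (k + 1)) ^ 2 ≤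
      (∫⁻ a, ((k + 1 : ℕ) : ℝ≥0∞) * ∫⁻ s, w a s ^ k * G a s) ^ 2 := by
        gcongr with a
        exact h2 k a b
    _ = (((k + 1 : ℕ) : ℝ≥0∞) * ∫⁻ z : ℝ × ℝ, w z.1 z.2 ^ k * G z.1 z.2) ^ 2 := by
        rw [lintegral_const_mul, hB1]
        exact (hm k).lintegral_prod_right'
    _ ≤ ((k + 1 : ℕ) : ℝ≥0∞) ^ 2 * ((((k.factorial : ℕ) : ℝ≥0∞) ^ 2 * volume Q * E ^ k) * E) := by
        rw [mul_pow]
        gcongr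
        exact (hB k).trans (by gcongr; exact hA k)
    _ = _ := by
        rw [Nat.factorial_succ]
        push_cast
        ring

theorem s6_ftc (φ φ' : ℝ → ℝ) (a b : ℝ) (hab : a ≤ b) (hc : ContinuousOn φ (Icc a b))
    (hd : ∀ x ∈ Ioo a b, HasDerivAt φ (φ' x) x) (hb : φ b = 0)
    (h0 : ∀ x ∈ Icc a b, 0 ≤ φ x) (k : ℕ) :
    ENNReal.ofReal (φ a) ^ (k + 1) ≤ ((k + 1 : ℕ) : ℝ≥0∞) *
      ∫⁻ x in Ioo a b, ENNReal.ofReal (φ x) ^ k * ENNReal.ofReal |φ' x| := by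
  set ψ : ℝ → ℝ := fun x => (k + 1) * (φ x ^ k * |φ' x|) with hψ
  have hmeas : AEStronglyMeasurable ψ (volume.restrict (Ioo a b)) := by
    have h1 : AEStronglyMeasurable φ (volume.restrict (Ioo a b)) :=
      (hc.mono Ioo_subset_Icc_self).aestronglyMeasurable measurableSet_Ioo
    have h2 : AEStronglyMeasurable φ' (volume.restrict (Ioo a b)) := by
      refine (measurable_deriv φ).aestronglyMeasurable.congr ?_
      filter_upwards [ae_restrict_mem measurableSet_Ioo] with x hx
      exact (hd x hx).deriv
    exact ((h1.pow k).mul h2.norm).const_mul _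
  have key : ((k + 1 : ℕ) : ℝ≥0∞) *
      ∫⁻ x in Ioo a b, ENNReal.ofReal (φ x) ^ k * ENNReal.ofReal |φ' x| =
      ∫⁻ x in Ioo a b, ENNReal.ofReal (ψ x) := by
    rw [← lintegral_const_mul' _ _ (by simp)]
    apply setLIntegral_congr_fun measurableSet_Ioo
    intro x hx
    have := h0 x (Ioo_subset_Icc_self hx)
    simp only [hψ]
    rw [ENNReal.ofReal_mul (by positivity), ENNReal.ofReal_mul (by positivity),
      ENNReal.ofReal_pow this]
    congr 1
    rw [← ENNReal.ofReal_natCast]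
    push_cast
    rfl
  rw [key]
  have hψ0 : 0 ≤ᵐ[volume.restrict (Ioo a b)] ψ := by
    filter_upwards [ae_restrict_mem measurableSet_Ioo] with x hx
    have := h0 x (Ioo_subset_Icc_self hx)
    simp only [hψ, Pi.zero_apply]
    positivity
  by_cases htop : ∫⁻ x in Ioo a b, ENNReal.ofReal (ψ x) = ∞
  · rw [htop]; exact le_top
  have hint : IntegrableOn ψ (Ioo a b) :=
    ⟨hmeas, (hasFiniteIntegral_iff_ofReal hψ0).2 (lt_top_iff_ne_top.2 htop)⟩
  have hint' : IntegrableOn ψ (Icc a b) := by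
    rwa [integrableOn_Icc_iff_integrableOn_Ioo]
  have := intervalIntegral.sub_le_integral_of_hasDeriv_right_of_le (g := fun x => -(φ x ^ (k + 1)))
    (g' := fun x => -(((k + 1 : ℕ) : ℝ) * φ x ^ k * φ' x)) (φ := ψ) hab (hc.pow _).neg
    (fun x hx => by
      have := ((hd x hx).fun_pow (k + 1)).fun_neg
      simpa using this.hasDerivWithinAt (s := Ioi x)) hint'
    (fun x hx => by
      have := h0 x (Ioo_subset_Icc_self hx)
      simp only [hψ]
      push_cast
      rw [mul_assoc, ← mul_neg, ← mul_neg]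
      gcongr
      exact neg_le_abs _)
  rw [intervalIntegral.integral_of_le hab, integral_Ioc_eq_integral_Ioo] at this
  rw [← ENNReal.ofReal_pow (h0 a ⟨le_rfl, hab⟩), ← ofReal_integral_eq_lintegral_ofReal hint hψ0]
  apply ENNReal.ofReal_le_ofReal
  simpa [hb] using this

noncomputable def s6_join {n : ℕ} (x : EuclideanSpace ℝ (Fin n)) (t : ℝ) :
    EuclideanSpace ℝ (Fin (n + 1)) :=
  WithLp.toLp 2 (Fin.snoc (α := fun _ => ℝ) (fun i => x i) t)

theorem s6_join_castSucc {n : ℕ} (x : EuclideanSpace ℝ (Fin n)) (t : ℝ) (i : Fin n) :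
    s6_join x t i.castSucc = x i := by
  simp [s6_join]

theorem s6_join_last {n : ℕ} (x : EuclideanSpace ℝ (Fin n)) (t : ℝ) :
    s6_join x t (Fin.last n) = t := by
  simp [s6_join]

theorem s6_join_eq {n : ℕ} (x : EuclideanSpace ℝ (Fin n)) (s t : ℝ) :
    s6_join (s • x) t = s • s6_join x 0 + t • s6_join 0 1 := by
  ext i
  refine Fin.lastCases ?_ (fun i => ?_) i
  · simp [s6_join_last]
  · simp [s6_join_castSucc]

theorem s6_join_norm_sq {n : ℕ} (x : EuclideanSpace ℝ (Fin n)) (t : ℝ) :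
    ‖s6_join x t‖ ^ 2 = ‖x‖ ^ 2 + t ^ 2 := by
  rw [EuclideanSpace.norm_sq_eq, EuclideanSpace.norm_sq_eq, Fin.sum_univ_castSucc]
  simp [s6_join_last, s6_join_castSucc]

theorem s6_embed {n : ℕ} (x : EuclideanSpace ℝ (Fin n)) :
    embedHyper (n + 1) x = s6_join x 0 := by
  ext i
  refine Fin.lastCases ?_ (fun i => ?_) i
  · rw [s6_join_last]
    simp [embedHyper]
  · rw [s6_join_castSucc]
    simp [embedHyper]

theorem s6_lastCoord {n : ℕ} (x : EuclideanSpace ℝ (Fin n)) (t : ℝ) :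
    lastCoord (s6_join x t) = t := by
  unfold lastCoord
  rw [dif_pos (Nat.succ_pos n)]
  exact s6_join_last x t

theorem s6_lintegral_join {n : ℕ} (F : EuclideanSpace ℝ (Fin (n + 1)) → ℝ≥0∞)
    (hF : Measurable F) :
    ∫⁻ x, F x = ∫⁻ t : ℝ, ∫⁻ x : EuclideanSpace ℝ (Fin n), F (s6_join x t) := by
  have e1 := (PiLp.volume_preserving_toLp (Fin (n + 1))).lintegral_comp hF
  have e2 := ((volume_preserving_piFinSuccAbove (fun _ : Fin (n + 1) => ℝ) (Fin.last n)).symm).lintegral_comp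
    (f := fun y : Fin (n + 1) → ℝ => F (WithLp.toLp 2 y)) (by fun_prop)
  rw [← e1, ← e2, Measure.volume_eq_prod, lintegral_prod _ (by fun_prop)]
  congr 1
  funext t
  have hm : Measurable fun x : EuclideanSpace ℝ (Fin n) => F (s6_join x t) := by
    apply hF.comp
    unfold s6_join
    apply (PiLp.continuous_toLp 2 _).measurable.comp
    apply measurable_pi_lambda
    intro i
    refine Fin.lastCases ?_ (fun i => ?_) i
    · simp
    · simp; fun_prop
  have e3 := (PiLp.volume_preserving_toLp (Fin n)).lintegral_comp hm
  rw [← e3]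
  congr 1
  funext y
  congr 2
  ext i
  refine Fin.lastCases ?_ (fun i => ?_) i
  · simp [MeasurableEquiv.piFinSuccAbove]
  · simp [MeasurableEquiv.piFinSuccAbove]

theorem s6_isOpen (N : ℕ) (R₀ R₁ : ℝ) : IsOpen (annulus N R₀ R₁) :=
  (isOpen_lt continuous_const continuous_norm).inter (isOpen_lt continuous_norm continuous_const)

theorem s6_compact (N : ℕ) (R₀ R₁ : ℝ) : IsCompact (closure (annulus N R₀ R₁)) := by
  apply Bornology.IsBounded.isCompact_closure
  apply (Metric.isBounded_closedBall (x := (0 : EuclideanSpace ℝ (Fin N))) (r := R₁)).subset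
  intro x hx
  simpa using hx.2.le

theorem s6_mem_closure (N : ℕ) (R₀ R₁ : ℝ) (h0 : 0 < R₀) (x : EuclideanSpace ℝ (Fin N))
    (h1 : R₀ < ‖x‖) (h2 : ‖x‖ ≤ R₁) : x ∈ closure (annulus N R₀ R₁) := by
  have ht : Filter.Tendsto (fun c : ℝ => c • x) (nhdsWithin 1 (Iio 1)) (nhds x) := by
    have : Filter.Tendsto (fun c : ℝ => c • x) (nhds 1) (nhds ((1 : ℝ) • x)) :=
      (continuous_id.smul continuous_const).tendsto 1
    rw [one_smul] at this
    exact this.mono_left nhdsWithin_le_nhds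
  refine mem_closure_of_tendsto ht ?_
  have hn : 0 < ‖x‖ := h0.trans h1
  have : Ioo (R₀ / ‖x‖) 1 ∈ nhdsWithin (1 : ℝ) (Iio 1) :=
    Ioo_mem_nhdsLT ((div_lt_one hn).2 h1)
  filter_upwards [this] with c hc
  have hc0 : 0 < c := (div_pos h0 hn).trans hc.1
  constructor
  · rw [norm_smul, Real.norm_eq_abs, abs_of_pos hc0]
    exact (div_lt_iff₀ hn).1 hc.1
  · rw [norm_smul, Real.norm_eq_abs, abs_of_pos hc0]
    nlinarith [hc.2]

theorem s6_bdd (N : ℕ) (R₀ R₁ : ℝ) (u : EuclideanSpace ℝ (Fin N) → ℝ)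
    (hu : ContDiffOn ℝ 1 u (closure (annulus N R₀ R₁))) :
    ∃ C : ℝ, ∀ x ∈ annulus N R₀ R₁, ‖fderiv ℝ u x‖ ≤ C := by
  have h := (s6_compact N R₀ R₁).induction_on
    (p := fun S => ∃ C : ℝ, ∀ x ∈ S ∩ annulus N R₀ R₁, ‖fderiv ℝ u x‖ ≤ C)
    ⟨0, by simp⟩
    (fun s t hst ⟨C, hC⟩ => ⟨C, fun x hx => hC x ⟨hst hx.1, hx.2⟩⟩)
    (fun s t ⟨C, hC⟩ ⟨D, hD⟩ => ⟨max C D, fun x hx => by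
      rcases hx with ⟨hx | hx, hx'⟩
      · exact (hC x ⟨hx, hx'⟩).trans (le_max_left _ _)
      · exact (hD x ⟨hx, hx'⟩).trans (le_max_right _ _)⟩)
    (fun x hx => by
      have h1 := hu x hx
      rw [show (1 : WithTop ℕ∞) = 0 + 1 by rfl,
        contDiffWithinAt_succ_iff_hasFDerivWithinAt (by simp)] at h1
      obtain ⟨v, hv, -, f', hf', hc⟩ := h1
      rw [insert_eq_of_mem hx] at hv
      have hc' := hc.continuousWithinAt
      have hb : ∀ᶠ y in nhdsWithin x (closure (annulus N R₀ R₁)), ‖f' y‖ < ‖f' x‖ + 1 :=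
        nhdsWithin_le_of_mem hv
          (hc'.norm.eventually_lt continuousWithinAt_const (by simp))
      obtain ⟨O, hO, hxO, hOv⟩ := mem_nhdsWithin.1 hv
      refine ⟨O ∩ {y | ‖f' y‖ < ‖f' x‖ + 1},
        Filter.inter_mem (mem_nhdsWithin_of_mem_nhds (hO.mem_nhds hxO)) hb, ‖f' x‖ + 1, ?_⟩
      rintro y ⟨⟨hyO, hy⟩, hyA⟩
      have hvy : v ∈ nhds y := by
        refine Filter.mem_of_superset ((hO.inter (s6_isOpen N R₀ R₁)).mem_nhds ⟨hyO, hyA⟩) ?_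
        exact fun z hz => hOv ⟨hz.1, subset_closure hz.2⟩
      have hyv : y ∈ v := mem_of_mem_nhds hvy
      rw [((hf' y hyv).hasFDerivAt hvy).fderiv]
      exact hy.le)
  obtain ⟨C, hC⟩ := h
  exact ⟨C, fun x hx => hC x ⟨subset_closure hx, hx⟩⟩

theorem s6_fderivWithin (N : ℕ) (R₀ R₁ : ℝ) (u : EuclideanSpace ℝ (Fin N) → ℝ)
    (x : EuclideanSpace ℝ (Fin N)) (hx : x ∈ annulus N R₀ R₁) :
    fderivWithin ℝ u (closure (annulus N R₀ R₁)) x = fderiv ℝ u x :=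
  fderivWithin_of_mem_nhds
    (Filter.mem_of_superset ((s6_isOpen N R₀ R₁).mem_nhds hx) subset_closure)

theorem s6_energy (N : ℕ) (R₀ R₁ : ℝ) (u : EuclideanSpace ℝ (Fin N) → ℝ)
    (hu : ContDiffOn ℝ 1 u (closure (annulus N R₀ R₁))) :
    ∫⁻ x in annulus N R₀ R₁, ENNReal.ofReal (‖fderiv ℝ u x‖ ^ 2) ≤
      ENNReal.ofReal (H1sq N R₀ R₁ u) := by
  have hA := s6_isOpen N R₀ R₁
  obtain ⟨C, hC⟩ := s6_bdd N R₀ R₁ u hu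
  obtain ⟨D, hD⟩ := (s6_compact N R₀ R₁).exists_bound_of_continuousOn hu.continuousOn
  have hfin : volume (annulus N R₀ R₁) ≠ ∞ :=
    ((measure_mono subset_closure).trans_lt (s6_compact N R₀ R₁).measure_lt_top).ne
  have hint : IntegrableOn (fun x => ‖fderiv ℝ u x‖ ^ 2 + (u x) ^ 2) (annulus N R₀ R₁) := by
    refine IntegrableOn.of_bound (C := C ^ 2 + D ^ 2) hfin.lt_top ?_ ?_
    · refine AEStronglyMeasurable.add ?_ ?_
      · exact ((measurable_fderiv ℝ u).norm.pow_const 2).aestronglyMeasurable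
      · exact ((hu.continuousOn.mono subset_closure).aestronglyMeasurable hA.measurableSet).pow 2
    · filter_upwards [ae_restrict_mem hA.measurableSet] with x hx
      have h1 := hC x hx
      have h2 := hD x (subset_closure hx)
      rw [Real.norm_eq_abs, abs_of_nonneg (by positivity)]
      have := sq_abs (u x)
      rw [Real.norm_eq_abs] at h2
      gcongr ?_ + ?_
      · gcongr
      · rw [← this]; gcongr
  have e : H1sq N R₀ R₁ u = ∫ x in annulus N R₀ R₁, (‖fderiv ℝ u x‖ ^ 2 + (u x) ^ 2) := by
    unfold H1sq
    apply setIntegral_congr_fun hA.measurableSet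
    intro x hx
    simp only
    rw [s6_fderivWithin N R₀ R₁ u x hx]
  rw [e, ofReal_integral_eq_lintegral_ofReal hint (Filter.Eventually.of_forall fun x => by positivity)]
  apply lintegral_mono
  intro x
  apply ENNReal.ofReal_le_ofReal
  nlinarith [sq_nonneg (u x)]

def s6_Q (R₀ R₁ : ℝ) : Set (ℝ × ℝ) := {z | R₀ < z.1 ∧ z.1 ^ 2 + z.2 ^ 2 < R₁ ^ 2}

theorem s6_Q_open (R₀ R₁ : ℝ) : IsOpen (s6_Q R₀ R₁) :=
  (isOpen_lt continuous_const continuous_fst).inter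
    (isOpen_lt ((continuous_fst.pow 2).add (continuous_snd.pow 2)) continuous_const)

theorem s6_Q_finite (R₀ R₁ : ℝ) : volume (s6_Q R₀ R₁) ≠ ∞ := by
  have : s6_Q R₀ R₁ ⊆ Icc (-|R₁|, -|R₁|) (|R₁|, |R₁|) := by
    rintro ⟨a, b⟩ ⟨-, h⟩
    simp only at h
    have ha := abs_le.1 (sq_le_sq.1 (by nlinarith [sq_nonneg b] : a ^ 2 ≤ R₁ ^ 2))
    have hb := abs_le.1 (sq_le_sq.1 (by nlinarith [sq_nonneg a] : b ^ 2 ≤ R₁ ^ 2))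
    exact ⟨⟨ha.1, hb.1⟩, ⟨ha.2, hb.2⟩⟩
  exact ((measure_mono this).trans_lt isCompact_Icc.measure_lt_top).ne

theorem s6_join_norm {n : ℕ} (ω : EuclideanSpace ℝ (Fin n)) (hω : ‖ω‖ = 1) (ρ t : ℝ) :
    ‖s6_join (ρ • ω) t‖ ^ 2 = ρ ^ 2 + t ^ 2 := by
  rw [s6_join_norm_sq, norm_smul, hω]
  simp

theorem s6_Q_mem {n : ℕ} (R₀ R₁ : ℝ) (h0 : 0 < R₀) (h1 : R₀ < R₁)
    (ω : EuclideanSpace ℝ (Fin n)) (hω : ‖ω‖ = 1)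
    (ρ t : ℝ) (h : (ρ, t) ∈ s6_Q R₀ R₁) : s6_join (ρ • ω) t ∈ annulus (n + 1) R₀ R₁ := by
  have e := s6_join_norm ω hω ρ t
  obtain ⟨ha, hb⟩ := h
  simp only at ha hb
  constructor
  · refine lt_of_pow_lt_pow_left₀ 2 (norm_nonneg _) ?_
    rw [e]
    nlinarith [sq_nonneg t]
  · refine lt_of_pow_lt_pow_left₀ 2 (by linarith) ?_
    rw [e]
    exact hb

theorem s6_line_h {n : ℕ} (ω : EuclideanSpace ℝ (Fin n)) (t s : ℝ) :
    HasDerivAt (fun s => s6_join (s • ω) t) (s6_join ω 0) s := by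
  simp only [s6_join_eq]
  have := ((hasDerivAt_id s).smul_const (s6_join ω 0)).add_const (t • s6_join (0 : EuclideanSpace ℝ (Fin n)) 1)
  simpa using this

theorem s6_line_v {n : ℕ} (ω : EuclideanSpace ℝ (Fin n)) (ρ s : ℝ) :
    HasDerivAt (fun s => s6_join (ρ • ω) s) (s6_join 0 1) s := by
  simp only [s6_join_eq ω]
  have := ((hasDerivAt_id s).smul_const (s6_join (0 : EuclideanSpace ℝ (Fin n)) 1)).const_add (ρ • s6_join ω 0)
  simpa using this

noncomputable def s6_Dh {n : ℕ} (u : EuclideanSpace ℝ (Fin (n + 1)) → ℝ) (ω : EuclideanSpace ℝ (Fin n))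
    (ρ t : ℝ) : ℝ := fderiv ℝ u (s6_join (ρ • ω) t) (s6_join ω 0)

noncomputable def s6_Dv {n : ℕ} (u : EuclideanSpace ℝ (Fin (n + 1)) → ℝ) (ω : EuclideanSpace ℝ (Fin n))
    (ρ t : ℝ) : ℝ := fderiv ℝ u (s6_join (ρ • ω) t) (s6_join 0 1)

theorem s6_diffAt (N : ℕ) (R₀ R₁ : ℝ) (u : EuclideanSpace ℝ (Fin N) → ℝ)
    (hu : ContDiffOn ℝ 1 u (closure (annulus N R₀ R₁))) (x : EuclideanSpace ℝ (Fin N))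
    (hx : x ∈ annulus N R₀ R₁) : DifferentiableAt ℝ u x :=
  ((hu.differentiableOn (by simp)).mono subset_closure).differentiableAt
    ((s6_isOpen N R₀ R₁).mem_nhds hx)

theorem s6_hasDeriv_h {n : ℕ} (R₀ R₁ : ℝ) (u : EuclideanSpace ℝ (Fin (n + 1)) → ℝ)
    (hu : ContDiffOn ℝ 1 u (closure (annulus (n + 1) R₀ R₁))) (ω : EuclideanSpace ℝ (Fin n))
    (ρ t : ℝ) (hx : s6_join (ρ • ω) t ∈ annulus (n + 1) R₀ R₁) :
    HasDerivAt (fun s => u (s6_join (s • ω) t)) (s6_Dh u ω ρ t) ρ :=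
  (s6_diffAt _ R₀ R₁ u hu _ hx).hasFDerivAt.comp_hasDerivAt ρ (s6_line_h ω t ρ)

theorem s6_hasDeriv_v {n : ℕ} (R₀ R₁ : ℝ) (u : EuclideanSpace ℝ (Fin (n + 1)) → ℝ)
    (hu : ContDiffOn ℝ 1 u (closure (annulus (n + 1) R₀ R₁))) (ω : EuclideanSpace ℝ (Fin n))
    (ρ t : ℝ) (hx : s6_join (ρ • ω) t ∈ annulus (n + 1) R₀ R₁) :
    HasDerivAt (fun s => u (s6_join (ρ • ω) s)) (s6_Dv u ω ρ t) t :=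
  (s6_diffAt _ R₀ R₁ u hu _ hx).hasFDerivAt.comp_hasDerivAt t (s6_line_v ω ρ t)

noncomputable def s6_w {n : ℕ} (R₀ R₁ : ℝ) (u : EuclideanSpace ℝ (Fin (n + 1)) → ℝ)
    (ω : EuclideanSpace ℝ (Fin n)) (ρ t : ℝ) : ℝ≥0∞ :=
  (s6_Q R₀ R₁).indicator (fun z => ENNReal.ofReal (u (s6_join (z.1 • ω) z.2))) (ρ, t)

noncomputable def s6_G {n : ℕ} (R₀ R₁ : ℝ) (u : EuclideanSpace ℝ (Fin (n + 1)) → ℝ)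
    (ω : EuclideanSpace ℝ (Fin n)) (ρ t : ℝ) : ℝ≥0∞ :=
  (s6_Q R₀ R₁).indicator (fun z => ENNReal.ofReal (max |s6_Dh u ω z.1 z.2| |s6_Dv u ω z.1 z.2|))
    (ρ, t)

theorem s6_cont {n : ℕ} (ω : EuclideanSpace ℝ (Fin n)) :
    Continuous fun z : ℝ × ℝ => s6_join (z.1 • ω) z.2 := by
  simp only [s6_join_eq ω]
  fun_prop

theorem s6_w_meas {n : ℕ} (R₀ R₁ : ℝ) (h0 : 0 < R₀) (h1 : R₀ < R₁)
    (u : EuclideanSpace ℝ (Fin (n + 1)) → ℝ)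
    (hu : ContDiffOn ℝ 1 u (closure (annulus (n + 1) R₀ R₁))) (ω : EuclideanSpace ℝ (Fin n))
    (hω : ‖ω‖ = 1) : Measurable (Function.uncurry (s6_w R₀ R₁ u ω)) := by
  classical
  have : Function.uncurry (s6_w R₀ R₁ u ω) =
      (s6_Q R₀ R₁).piecewise (fun z => ENNReal.ofReal (u (s6_join (z.1 • ω) z.2))) (fun _ => 0) := by
    funext z
    simp [Function.uncurry, s6_w, indicator, piecewise]
  rw [this]
  refine ContinuousOn.measurable_piecewise ?_ continuousOn_const (s6_Q_open R₀ R₁).measurableSet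
  refine ENNReal.continuous_ofReal.comp_continuousOn ?_
  refine hu.continuousOn.comp (s6_cont ω).continuousOn ?_
  intro z hz
  exact subset_closure (s6_Q_mem R₀ R₁ h0 h1 ω hω z.1 z.2 hz)

theorem s6_G_meas {n : ℕ} (R₀ R₁ : ℝ) (u : EuclideanSpace ℝ (Fin (n + 1)) → ℝ)
    (ω : EuclideanSpace ℝ (Fin n)) : Measurable (Function.uncurry (s6_G R₀ R₁ u ω)) := by
  have h : Measurable (fun z : ℝ × ℝ =>
      ENNReal.ofReal (max |s6_Dh u ω z.1 z.2| |s6_Dv u ω z.1 z.2|)) := by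
    have a1 : Measurable fun z : ℝ × ℝ => s6_Dh u ω z.1 z.2 :=
      (measurable_fderiv_apply_const ℝ u (s6_join ω 0)).comp (s6_cont ω).measurable
    have a2 : Measurable fun z : ℝ × ℝ => s6_Dv u ω z.1 z.2 :=
      (measurable_fderiv_apply_const ℝ u (s6_join 0 1)).comp (s6_cont ω).measurable
    exact ((continuous_abs.measurable.comp a1).max (continuous_abs.measurable.comp a2)).ennreal_ofReal
  exact h.indicator (s6_Q_open R₀ R₁).measurableSet

theorem s6_ineq_h {n : ℕ} (R₀ R₁ : ℝ) (h0 : 0 < R₀) (h1 : R₀ < R₁)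
    (u : EuclideanSpace ℝ (Fin (n + 1)) → ℝ) (hu : memK (n + 1) R₀ R₁ u)
    (ω : EuclideanSpace ℝ (Fin n)) (hω : ‖ω‖ = 1) (k : ℕ) (a b : ℝ) :
    s6_w R₀ R₁ u ω a b ^ (k + 1) ≤ ((k + 1 : ℕ) : ℝ≥0∞) *
      ∫⁻ s, s6_w R₀ R₁ u ω s b ^ k * s6_G R₀ R₁ u ω s b := by
  by_cases hab : (a, b) ∈ s6_Q R₀ R₁
  swap
  · simp [s6_w, hab]
  have hab' := hab
  obtain ⟨ha, hb⟩ := hab'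
  simp only at ha hb
  set s1 := √(R₁ ^ 2 - b ^ 2) with hs1
  have hs1sq : s1 ^ 2 = R₁ ^ 2 - b ^ 2 := Real.sq_sqrt (by nlinarith [sq_nonneg a])
  have has : a < s1 := Real.lt_sqrt_of_sq_lt (by linarith)
  have hmem : ∀ s ∈ Ico a s1, (s, b) ∈ s6_Q R₀ R₁ := fun s hs =>
    ⟨ha.trans_le hs.1, by simp only; nlinarith [hs.1, hs.2]⟩
  have hnorm : ‖s6_join (s1 • ω) b‖ = R₁ := by
    have e := s6_join_norm ω hω s1 b
    rw [hs1sq, sub_add_cancel] at e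
    exact (pow_left_inj₀ (norm_nonneg _) (by linarith) two_ne_zero).1 e
  have hcl : ∀ s ∈ Icc a s1, s6_join (s • ω) b ∈ closure (annulus (n + 1) R₀ R₁) := by
    intro s hs
    rcases hs.2.lt_or_eq with h | rfl
    · exact subset_closure (s6_Q_mem R₀ R₁ h0 h1 ω hω s b (hmem s ⟨hs.1, h⟩))
    · exact s6_mem_closure _ R₀ R₁ h0 _ (by rw [hnorm]; exact h1) hnorm.le
  have key := s6_ftc (fun s => u (s6_join (s • ω) b)) (fun s => s6_Dh u ω s b) a s1 has.le
    (hu.1.1.continuousOn.comp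
      ((s6_cont ω).comp (Continuous.prodMk_left b)).continuousOn hcl)
    (fun s hs => s6_hasDeriv_h R₀ R₁ u hu.1.1 ω s b
      (s6_Q_mem R₀ R₁ h0 h1 ω hω s b (hmem s ⟨hs.1.le, hs.2⟩)))
    (hu.2 _ (Or.inr hnorm)) (fun s hs => hu.1.2.1 _ (hcl s hs)) k
  have e : s6_w R₀ R₁ u ω a b = ENNReal.ofReal (u (s6_join (a • ω) b)) := by
    simp [s6_w, hab]
  rw [e]
  refine key.trans (mul_le_mul' le_rfl ?_)
  refine le_trans ?_ (setLIntegral_le_lintegral (Ioo a s1) _)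
  refine setLIntegral_mono' measurableSet_Ioo fun s hs => ?_
  have hsQ := hmem s ⟨hs.1.le, hs.2⟩
  simp only [s6_w, s6_G, indicator_of_mem hsQ]
  gcongr
  exact le_max_left _ _

theorem s6_ineq_v {n : ℕ} (R₀ R₁ : ℝ) (h0 : 0 < R₀) (h1 : R₀ < R₁)
    (u : EuclideanSpace ℝ (Fin (n + 1)) → ℝ) (hu : memK (n + 1) R₀ R₁ u)
    (ω : EuclideanSpace ℝ (Fin n)) (hω : ‖ω‖ = 1) (k : ℕ) (a b : ℝ) :
    s6_w R₀ R₁ u ω a b ^ (k + 1) ≤ ((k + 1 : ℕ) : ℝ≥0∞) *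
      ∫⁻ s, s6_w R₀ R₁ u ω a s ^ k * s6_G R₀ R₁ u ω a s := by
  by_cases hab : (a, b) ∈ s6_Q R₀ R₁
  swap
  · simp [s6_w, hab]
  have hab' := hab
  obtain ⟨ha, hb⟩ := hab'
  simp only at ha hb
  set s1 := √(R₁ ^ 2 - a ^ 2) with hs1
  have hs1sq : s1 ^ 2 = R₁ ^ 2 - a ^ 2 := Real.sq_sqrt (by nlinarith [sq_nonneg b])
  have has : |b| < s1 := Real.lt_sqrt_of_sq_lt (by rw [sq_abs]; linarith)
  obtain ⟨hb1, hb2⟩ := abs_lt.1 has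
  have hmem : ∀ s ∈ Ico b s1, (a, s) ∈ s6_Q R₀ R₁ := fun s hs =>
    ⟨ha, by simp only; nlinarith [hs.1, hs.2]⟩
  have hnorm : ‖s6_join (a • ω) s1‖ = R₁ := by
    have e := s6_join_norm ω hω a s1
    rw [hs1sq, add_sub_cancel] at e
    exact (pow_left_inj₀ (norm_nonneg _) (by linarith) two_ne_zero).1 e
  have hcl : ∀ s ∈ Icc b s1, s6_join (a • ω) s ∈ closure (annulus (n + 1) R₀ R₁) := by
    intro s hs
    rcases hs.2.lt_or_eq with h | rfl
    · exact subset_closure (s6_Q_mem R₀ R₁ h0 h1 ω hω a s (hmem s ⟨hs.1, h⟩))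
    · exact s6_mem_closure _ R₀ R₁ h0 _ (by rw [hnorm]; exact h1) hnorm.le
  have hcont : Continuous fun s => s6_join (a • ω) s :=
    (s6_cont ω).comp (Continuous.prodMk_right a)
  have key := s6_ftc (fun s => u (s6_join (a • ω) s)) (fun s => s6_Dv u ω a s) b s1 hb2.le
    (hu.1.1.continuousOn.comp hcont.continuousOn hcl)
    (fun s hs => s6_hasDeriv_v R₀ R₁ u hu.1.1 ω a s
      (s6_Q_mem R₀ R₁ h0 h1 ω hω a s (hmem s ⟨hs.1.le, hs.2⟩)))
    (hu.2 _ (Or.inr hnorm)) (fun s hs => hu.1.2.1 _ (hcl s hs)) k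
  have e : s6_w R₀ R₁ u ω a b = ENNReal.ofReal (u (s6_join (a • ω) b)) := by
    simp [s6_w, hab]
  rw [e]
  refine key.trans (mul_le_mul' le_rfl ?_)
  refine le_trans ?_ (setLIntegral_le_lintegral (Ioo b s1) _)
  refine setLIntegral_mono' measurableSet_Ioo fun s hs => ?_
  have hsQ := hmem s ⟨hs.1.le, hs.2⟩
  simp only [s6_w, s6_G, indicator_of_mem hsQ]
  gcongr
  exact le_max_right _ _

theorem s6_sym {n : ℕ} (R₀ R₁ : ℝ) (h0 : 0 < R₀) (h1 : R₀ < R₁)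
    (u : EuclideanSpace ℝ (Fin (n + 1)) → ℝ) (hu : memK (n + 1) R₀ R₁ u)
    (ω η : EuclideanSpace ℝ (Fin n)) (hω : ‖ω‖ = 1) (hη : ‖η‖ = 1) (ρ t : ℝ)
    (h : (ρ, t) ∈ s6_Q R₀ R₁) : u (s6_join (ρ • ω) t) = u (s6_join (ρ • η) t) := by
  obtain ⟨⟨-, -, f, hf, -⟩, -⟩ := hu
  have hn : ‖s6_join (ρ • ω) t‖ = ‖s6_join (ρ • η) t‖ := by
    have e := (s6_join_norm ω hω ρ t).trans (s6_join_norm η hη ρ t).symm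
    exact (pow_left_inj₀ (norm_nonneg _) (norm_nonneg _) two_ne_zero).1 e
  rw [hf _ (subset_closure (s6_Q_mem R₀ R₁ h0 h1 ω hω ρ t h)),
    hf _ (subset_closure (s6_Q_mem R₀ R₁ h0 h1 η hη ρ t h))]
  unfold angleOf
  rw [s6_lastCoord, s6_lastCoord, hn]

theorem s6_sym_h {n : ℕ} (R₀ R₁ : ℝ) (h0 : 0 < R₀) (h1 : R₀ < R₁)
    (u : EuclideanSpace ℝ (Fin (n + 1)) → ℝ) (hu : memK (n + 1) R₀ R₁ u)
    (ω η : EuclideanSpace ℝ (Fin n)) (hω : ‖ω‖ = 1) (hη : ‖η‖ = 1) (ρ t : ℝ)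
    (h : (ρ, t) ∈ s6_Q R₀ R₁) : s6_Dh u ω ρ t = s6_Dh u η ρ t := by
  have a1 := s6_hasDeriv_h R₀ R₁ u hu.1.1 ω ρ t (s6_Q_mem R₀ R₁ h0 h1 ω hω ρ t h)
  have a2 := s6_hasDeriv_h R₀ R₁ u hu.1.1 η ρ t (s6_Q_mem R₀ R₁ h0 h1 η hη ρ t h)
  refine a1.unique (a2.congr_of_eventuallyEq ?_)
  have : ∀ᶠ s in nhds ρ, (s, t) ∈ s6_Q R₀ R₁ :=
    (Continuous.prodMk_left t).continuousAt.eventually_mem ((s6_Q_open R₀ R₁).mem_nhds h)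
  filter_upwards [this] with s hs
  exact s6_sym R₀ R₁ h0 h1 u hu ω η hω hη s t hs

theorem s6_sym_v {n : ℕ} (R₀ R₁ : ℝ) (h0 : 0 < R₀) (h1 : R₀ < R₁)
    (u : EuclideanSpace ℝ (Fin (n + 1)) → ℝ) (hu : memK (n + 1) R₀ R₁ u)
    (ω η : EuclideanSpace ℝ (Fin n)) (hω : ‖ω‖ = 1) (hη : ‖η‖ = 1) (ρ t : ℝ)
    (h : (ρ, t) ∈ s6_Q R₀ R₁) : s6_Dv u ω ρ t = s6_Dv u η ρ t := by
  have a1 := s6_hasDeriv_v R₀ R₁ u hu.1.1 ω ρ t (s6_Q_mem R₀ R₁ h0 h1 ω hω ρ t h)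
  have a2 := s6_hasDeriv_v R₀ R₁ u hu.1.1 η ρ t (s6_Q_mem R₀ R₁ h0 h1 η hη ρ t h)
  refine a1.unique (a2.congr_of_eventuallyEq ?_)
  have : ∀ᶠ s in nhds t, (ρ, s) ∈ s6_Q R₀ R₁ :=
    (Continuous.prodMk_right ρ).continuousAt.eventually_mem ((s6_Q_open R₀ R₁).mem_nhds h)
  filter_upwards [this] with s hs
  exact s6_sym R₀ R₁ h0 h1 u hu ω η hω hη ρ s hs

theorem s6_G_le {n : ℕ} (R₀ R₁ : ℝ) (h0 : 0 < R₀) (h1 : R₀ < R₁)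
    (u : EuclideanSpace ℝ (Fin (n + 1)) → ℝ) (hu : memK (n + 1) R₀ R₁ u)
    (e : EuclideanSpace ℝ (Fin n)) (he : ‖e‖ = 1) (x : EuclideanSpace ℝ (Fin n)) (t : ℝ) :
    s6_G R₀ R₁ u e ‖x‖ t ^ 2 ≤ (annulus (n + 1) R₀ R₁).indicator
      (fun y => ENNReal.ofReal (‖fderiv ℝ u y‖ ^ 2)) (s6_join x t) := by
  by_cases hQ : (‖x‖, t) ∈ s6_Q R₀ R₁
  swap
  · simp [s6_G, hQ]
  have hx : 0 < ‖x‖ := h0.trans hQ.1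
  set ω : EuclideanSpace ℝ (Fin n) := ‖x‖⁻¹ • x with hωd
  have hω : ‖ω‖ = 1 := by
    rw [hωd, norm_smul, norm_inv, norm_norm, inv_mul_cancel₀ hx.ne']
  have hxω : x = ‖x‖ • ω := by
    rw [hωd, smul_smul, mul_inv_cancel₀ hx.ne', one_smul]
  have hmem := s6_Q_mem R₀ R₁ h0 h1 ω hω ‖x‖ t hQ
  rw [← hxω] at hmem
  rw [indicator_of_mem hmem]
  simp only [s6_G, indicator_of_mem hQ]
  rw [s6_sym_h R₀ R₁ h0 h1 u hu e ω he hω _ _ hQ, s6_sym_v R₀ R₁ h0 h1 u hu e ω he hω _ _ hQ,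
    ← ENNReal.ofReal_pow (by positivity)]
  apply ENNReal.ofReal_le_ofReal
  gcongr
  have n1 : ‖s6_join ω 0‖ = 1 := by
    have := s6_join_norm_sq ω 0
    rw [hω] at this
    exact (pow_left_inj₀ (norm_nonneg _) zero_le_one two_ne_zero).1 (by simpa using this)
  have n2 : ‖s6_join (0 : EuclideanSpace ℝ (Fin n)) 1‖ = 1 := by
    have := s6_join_norm_sq (0 : EuclideanSpace ℝ (Fin n)) 1
    exact (pow_left_inj₀ (norm_nonneg _) zero_le_one two_ne_zero).1 (by simpa using this)
  apply max_le
  · unfold s6_Dh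
    rw [← hxω]
    have := (fderiv ℝ u (s6_join x t)).le_opNorm (s6_join ω 0)
    rwa [n1, mul_one] at this
  · unfold s6_Dv
    rw [← hxω]
    have := (fderiv ℝ u (s6_join x t)).le_opNorm (s6_join 0 1)
    rwa [n2, mul_one] at this

theorem s6_energy2 {n : ℕ} [Nontrivial (EuclideanSpace ℝ (Fin n))] (R₀ R₁ : ℝ) (h0 : 0 < R₀) (h1 : R₀ < R₁)
    (u : EuclideanSpace ℝ (Fin (n + 1)) → ℝ) (hu : memK (n + 1) R₀ R₁ u)
    (e : EuclideanSpace ℝ (Fin n)) (he : ‖e‖ = 1) :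
    (volume : Measure (EuclideanSpace ℝ (Fin n))).toSphere univ * ENNReal.ofReal (R₀ ^ (n - 1)) *
      ∫⁻ z : ℝ × ℝ, s6_G R₀ R₁ u e z.1 z.2 ^ 2 ≤ ENNReal.ofReal (H1sq (n + 1) R₀ R₁ u) := by
  have hGm : Measurable fun z : ℝ × ℝ => s6_G R₀ R₁ u e z.1 z.2 := s6_G_meas R₀ R₁ u e
  refine le_trans ?_ (s6_energy (n + 1) R₀ R₁ u hu.1.1)
  rw [← lintegral_indicator (s6_isOpen _ R₀ R₁).measurableSet, s6_lintegral_join]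
  swap
  · exact ((measurable_fderiv ℝ u).norm.pow_const 2).ennreal_ofReal.indicator
      (s6_isOpen _ R₀ R₁).measurableSet
  rw [Measure.volume_eq_prod, lintegral_prod_symm _ (hGm.pow_const 2).aemeasurable,
    ← lintegral_const_mul _ (hGm.pow_const 2).lintegral_prod_left']
  apply lintegral_mono
  intro t
  have hGt : Measurable fun ρ : ℝ => s6_G R₀ R₁ u e ρ t :=
    hGm.comp (f := fun ρ : ℝ => (ρ, t)) (by fun_prop)
  have step := lintegral_mono (μ := (volume : Measure (EuclideanSpace ℝ (Fin n))))
    (fun x => s6_G_le R₀ R₁ h0 h1 u hu e he x t)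
  refine le_trans ?_ step
  change (volume : Measure (EuclideanSpace ℝ (Fin n))).toSphere univ *
    ENNReal.ofReal (R₀ ^ (n - 1)) * (∫⁻ ρ : ℝ, s6_G R₀ R₁ u e ρ t ^ 2) ≤ _
  rw [s6_lintegral_fun_norm volume (fun ρ => s6_G R₀ R₁ u e ρ t ^ 2) (hGt.pow_const 2), mul_assoc,
    finrank_euclideanSpace_fin]
  refine mul_le_mul' le_rfl ?_
  rw [← lintegral_const_mul _ (hGt.pow_const 2), ← lintegral_indicator measurableSet_Ioi]
  apply lintegral_mono
  intro ρ
  by_cases hρ : R₀ < ρ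
  · rw [indicator_of_mem (show ρ ∈ Ioi (0 : ℝ) from h0.trans hρ)]
    simp only
    gcongr
  · have : (ρ, t) ∉ s6_Q R₀ R₁ := fun h => hρ h.1
    simp [s6_G, this]

theorem s6_trace {n : ℕ} [Nontrivial (EuclideanSpace ℝ (Fin n))] (R₀ R₁ : ℝ) (h0 : 0 < R₀) (h1 : R₀ < R₁)
    (u : EuclideanSpace ℝ (Fin (n + 1)) → ℝ) (hu : memK (n + 1) R₀ R₁ u)
    (e : EuclideanSpace ℝ (Fin n)) (he : ‖e‖ = 1) (k : ℕ) :
    ∫⁻ x in annulus n R₀ R₁, ‖u (s6_join x 0)‖ₑ ^ (k + 1) ≤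
    (volume : Measure (EuclideanSpace ℝ (Fin n))).toSphere univ * (ENNReal.ofReal (R₁ ^ (n - 1)) *
      ∫⁻ ρ : ℝ, s6_w R₀ R₁ u e ρ 0 ^ (k + 1)) := by
  have hwm : Measurable fun z : ℝ × ℝ => s6_w R₀ R₁ u e z.1 z.2 :=
    s6_w_meas R₀ R₁ h0 h1 u hu.1.1 e he
  have hwt : Measurable fun ρ : ℝ => s6_w R₀ R₁ u e ρ 0 :=
    hwm.comp (f := fun ρ : ℝ => (ρ, (0 : ℝ))) (by fun_prop)
  have e1 : ∫⁻ x in annulus n R₀ R₁, ‖u (s6_join x 0)‖ₑ ^ (k + 1) ≤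
      ∫⁻ x : EuclideanSpace ℝ (Fin n), s6_w R₀ R₁ u e ‖x‖ 0 ^ (k + 1) := by
    refine le_trans (setLIntegral_mono' (s6_isOpen n R₀ R₁).measurableSet fun x hx => ?_)
      (setLIntegral_le_lintegral (annulus n R₀ R₁) _)
    have hQ : (‖x‖, (0 : ℝ)) ∈ s6_Q R₀ R₁ :=
      ⟨hx.1, by simp only; nlinarith [hx.1, hx.2]⟩
    have hxp : 0 < ‖x‖ := h0.trans hQ.1
    set ω : EuclideanSpace ℝ (Fin n) := ‖x‖⁻¹ • x with hωd
    have hω : ‖ω‖ = 1 := by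
      rw [hωd, norm_smul, norm_inv, norm_norm, inv_mul_cancel₀ hxp.ne']
    have hxω : x = ‖x‖ • ω := by
      rw [hωd, smul_smul, mul_inv_cancel₀ hxp.ne', one_smul]
    have hmem := s6_Q_mem R₀ R₁ h0 h1 e he ‖x‖ 0 hQ
    have hs := s6_sym R₀ R₁ h0 h1 u hu ω e hω he ‖x‖ 0 hQ
    rw [← hxω] at hs
    simp only [s6_w, indicator_of_mem hQ]
    rw [hs, Real.enorm_of_nonneg (hu.1.2.1 _ (subset_closure hmem))]
  refine e1.trans ?_
  rw [s6_lintegral_fun_norm volume (fun ρ => s6_w R₀ R₁ u e ρ 0 ^ (k + 1)) (hwt.pow_const _),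
    finrank_euclideanSpace_fin]
  refine mul_le_mul' le_rfl ?_
  rw [← lintegral_const_mul _ (hwt.pow_const _), ← lintegral_indicator measurableSet_Ioi]
  apply lintegral_mono
  intro ρ
  by_cases hQ : (ρ, (0 : ℝ)) ∈ s6_Q R₀ R₁
  · have hρ : 0 < ρ := h0.trans hQ.1
    rw [indicator_of_mem (show ρ ∈ Ioi (0 : ℝ) from hρ)]
    have hle : ρ ≤ R₁ := by
      have := hQ.2
      simp only at this
      nlinarith
    simp only
    gcongr
  · by_cases hρ : ρ ∈ Ioi (0 : ℝ) <;> simp [s6_w, hQ]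

theorem s6_trace2 {n : ℕ} [Nontrivial (EuclideanSpace ℝ (Fin n))] (R₀ R₁ : ℝ) (h0 : 0 < R₀)
    (h1 : R₀ < R₁) (k : ℕ) : ∃ C : ℝ≥0∞, C ≠ ∞ ∧
    ∀ (u : EuclideanSpace ℝ (Fin (n + 1)) → ℝ), memK (n + 1) R₀ R₁ u →
      (∫⁻ x in annulus n R₀ R₁, ‖u (s6_join x 0)‖ₑ ^ (k + 1)) ^ 2 ≤
        C * ENNReal.ofReal (H1sq (n + 1) R₀ R₁ u) ^ (k + 1) := by
  obtain ⟨e, he⟩ := exists_norm_eq (EuclideanSpace ℝ (Fin n)) zero_le_one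
  set σ := (volume : Measure (EuclideanSpace ℝ (Fin n))).toSphere univ with hσ
  set c := σ * ENNReal.ofReal (R₀ ^ (n - 1)) with hc
  have hσ0 : σ ≠ 0 := by
    rw [hσ, Ne, Measure.measure_univ_eq_zero]
    exact Measure.toSphere_ne_zero _
  have hσt : σ ≠ ∞ := measure_ne_top _ _
  have hc0 : c ≠ 0 := mul_ne_zero hσ0 (by simpa using pow_pos h0 _)
  have hct : c ≠ ∞ := ENNReal.mul_ne_top hσt ENNReal.ofReal_ne_top
  refine ⟨(σ * ENNReal.ofReal (R₁ ^ (n - 1))) ^ 2 *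
    (((k + 1).factorial : ℝ≥0∞) ^ 2 * volume (s6_Q R₀ R₁)) * (c⁻¹) ^ (k + 1), ?_, ?_⟩
  · refine ENNReal.mul_ne_top (ENNReal.mul_ne_top (ENNReal.pow_ne_top
      (ENNReal.mul_ne_top hσt ENNReal.ofReal_ne_top)) (ENNReal.mul_ne_top
      (ENNReal.pow_ne_top (ENNReal.natCast_ne_top _)) (s6_Q_finite R₀ R₁)))
      (ENNReal.pow_ne_top (ENNReal.inv_ne_top.2 hc0))
  intro u hu
  have hE : ∫⁻ z : ℝ × ℝ, s6_G R₀ R₁ u e z.1 z.2 ^ 2 ≤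
      c⁻¹ * ENNReal.ofReal (H1sq (n + 1) R₀ R₁ u) := by
    have := s6_energy2 R₀ R₁ h0 h1 u hu e he
    rw [mul_comm c⁻¹, ← div_eq_mul_inv, ENNReal.le_div_iff_mul_le (Or.inl hc0) (Or.inl hct), mul_comm]
    exact this
  have hL := s6_lady (s6_w R₀ R₁ u e) (s6_G R₀ R₁ u e) (s6_w_meas R₀ R₁ h0 h1 u hu.1.1 e he)
    (s6_G_meas R₀ R₁ u e) (s6_Q R₀ R₁) (s6_Q_open R₀ R₁).measurableSet
    (fun a b h => by simp [s6_G, h]) (s6_ineq_h R₀ R₁ h0 h1 u hu e he)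
    (s6_ineq_v R₀ R₁ h0 h1 u hu e he) k 0
  have hT := s6_trace R₀ R₁ h0 h1 u hu e he k
  calc _ ≤ _ := pow_le_pow_left' hT 2
    _ = (σ * ENNReal.ofReal (R₁ ^ (n - 1))) ^ 2 * (∫⁻ ρ : ℝ, s6_w R₀ R₁ u e ρ 0 ^ (k + 1)) ^ 2 := by
      rw [← mul_assoc, mul_pow]
    _ ≤ (σ * ENNReal.ofReal (R₁ ^ (n - 1))) ^ 2 *
        (((k + 1).factorial : ℝ≥0∞) ^ 2 * volume (s6_Q R₀ R₁) *
          (c⁻¹ * ENNReal.ofReal (H1sq (n + 1) R₀ R₁ u)) ^ (k + 1)) := by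
      gcongr
      exact hL.trans (by gcongr)
    _ = _ := by
      rw [mul_pow c⁻¹]
      ring

theorem s6_main {n : ℕ} [Nontrivial (EuclideanSpace ℝ (Fin n))] (R₀ R₁ : ℝ) (h0 : 0 < R₀)
    (h1 : R₀ < R₁) (q : ℝ) (hq : 1 ≤ q) : ∃ C₁ : ℝ, 0 < C₁ ∧
      ∀ u : EuclideanSpace ℝ (Fin (n + 1)) → ℝ, memK (n + 1) R₀ R₁ u →
        (∫ x' in annulus n R₀ R₁, |u (embedHyper (n + 1) x')| ^ q) ^ (1 / q)
          ≤ C₁ * Real.sqrt (H1sq (n + 1) R₀ R₁ u) := by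
  obtain ⟨k, hk⟩ : ∃ k : ℕ, q ≤ k + 1 := by
    obtain ⟨k, hk⟩ := exists_nat_ge q
    exact ⟨k, by linarith⟩
  obtain ⟨C, hC, hCu⟩ := s6_trace2 (n := n) R₀ R₁ h0 h1 k
  have hq0 : 0 < q := by linarith
  set ν := (volume : Measure (EuclideanSpace ℝ (Fin n))).restrict (annulus n R₀ R₁) with hν
  have hνfin : ν univ ≠ ∞ := by
    rw [hν, Measure.restrict_apply_univ]
    exact ((measure_mono subset_closure).trans_lt (s6_compact n R₀ R₁).measure_lt_top).ne
  set p : ℝ := (k : ℝ) + 1 with hp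
  have hp0 : 0 < p := by positivity
  set M : ℝ≥0∞ := C ^ (1 / (2 * p)) * ν univ ^ (1 / q - 1 / p) with hM
  have hMt : M ≠ ∞ := by
    refine ENNReal.mul_ne_top (ENNReal.rpow_ne_top_of_nonneg (by positivity) hC)
      (ENNReal.rpow_ne_top_of_nonneg ?_ hνfin)
    rw [sub_nonneg]
    exact one_div_le_one_div_of_le hq0 hk
  refine ⟨M.toReal + 1, by positivity, fun u hu => ?_⟩
  have hcont : ContinuousOn (fun x : EuclideanSpace ℝ (Fin n) => u (s6_join x 0)) (annulus n R₀ R₁) := by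
    refine hu.1.1.continuousOn.comp ?_ ?_
    · refine Continuous.continuousOn ?_
      unfold s6_join
      refine (PiLp.continuous_toLp 2 _).comp (continuous_pi fun i => ?_)
      refine Fin.lastCases ?_ (fun i => ?_) i
      · simp only [Fin.snoc_last]; fun_prop
      · simp only [Fin.snoc_castSucc]; fun_prop
    · intro x hx
      apply subset_closure
      have := s6_join_norm_sq x 0
      have e : ‖s6_join x 0‖ = ‖x‖ :=
        (pow_left_inj₀ (norm_nonneg _) (norm_nonneg _) two_ne_zero).1 (by simpa using this)
      exact ⟨by rw [e]; exact hx.1, by rw [e]; exact hx.2⟩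
  set f : EuclideanSpace ℝ (Fin n) → ℝ := fun x => u (s6_join x 0) with hf
  have hfm : AEStronglyMeasurable f ν := hcont.aestronglyMeasurable (s6_isOpen n R₀ R₁).measurableSet
  have hmain : eLpNorm f (ENNReal.ofReal q) ν ≤
      M * ENNReal.ofReal (H1sq (n + 1) R₀ R₁ u) ^ (1 / 2 : ℝ) := by
    have a1 := eLpNorm_le_eLpNorm_mul_rpow_measure_univ (μ := ν) (f := f)
      (p := ENNReal.ofReal q) (q := ENNReal.ofReal p) (ENNReal.ofReal_le_ofReal hk) hfm
    rw [ENNReal.toReal_ofReal hq0.le, ENNReal.toReal_ofReal hp0.le] at a1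
    have a2 : eLpNorm f (ENNReal.ofReal p) ν ≤
        C ^ (1 / (2 * p)) * ENNReal.ofReal (H1sq (n + 1) R₀ R₁ u) ^ (1 / 2 : ℝ) := by
      rw [eLpNorm_eq_lintegral_rpow_enorm_toReal (by simpa using hp0) ENNReal.ofReal_ne_top,
        ENNReal.toReal_ofReal hp0.le]
      have e : ∫⁻ x, ‖f x‖ₑ ^ p ∂ν = ∫⁻ x, ‖f x‖ₑ ^ (k + 1) ∂ν := by
        congr 1
        funext x
        rw [hp, ← ENNReal.rpow_natCast]
        push_cast
        rfl
      rw [e]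
      have b := ENNReal.rpow_le_rpow (hCu u hu) (show 0 ≤ 1 / (2 * p) by positivity)
      rw [ENNReal.mul_rpow_of_nonneg _ _ (by positivity), ← ENNReal.rpow_natCast,
        ← ENNReal.rpow_natCast, ← ENNReal.rpow_mul, ← ENNReal.rpow_mul] at b
      have c1 : ((2 : ℕ) : ℝ) * (1 / (2 * p)) = 1 / p := by push_cast; field_simp
      have c2 : ((k + 1 : ℕ) : ℝ) * (1 / (2 * p)) = 1 / 2 := by
        push_cast
        rw [← hp]
        field_simp
      rw [c1, c2] at b
      exact b
    calc _ ≤ _ := a1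
      _ ≤ (C ^ (1 / (2 * p)) * ENNReal.ofReal (H1sq (n + 1) R₀ R₁ u) ^ (1 / 2 : ℝ)) *
          ν univ ^ (1 / q - 1 / p) := by gcongr
      _ = _ := by rw [hM]; ring
  have hfin : M * ENNReal.ofReal (H1sq (n + 1) R₀ R₁ u) ^ (1 / 2 : ℝ) ≠ ∞ :=
    ENNReal.mul_ne_top hMt (ENNReal.rpow_ne_top_of_nonneg (by norm_num) ENNReal.ofReal_ne_top)
  have hH : 0 ≤ H1sq (n + 1) R₀ R₁ u := integral_nonneg fun x => by positivity
  have hlhs : (∫ x' in annulus n R₀ R₁, |u (embedHyper (n + 1) x')| ^ q) ^ (1 / q) =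
      (eLpNorm f (ENNReal.ofReal q) ν).toReal := by
    rw [eLpNorm_eq_lintegral_rpow_enorm_toReal (by simpa using hq0) ENNReal.ofReal_ne_top,
      ENNReal.toReal_ofReal hq0.le, ← ENNReal.toReal_rpow]
    congr 1
    rw [integral_eq_lintegral_of_nonneg_ae (Filter.Eventually.of_forall fun x => by positivity)]
    · congr 2
      funext x
      have : u (embedHyper (n + 1) x) = f x := by rw [hf, s6_embed]
      rw [this, Real.enorm_eq_ofReal_abs, ENNReal.ofReal_rpow_of_nonneg (abs_nonneg _) hq0.le]
    · have : (fun x : EuclideanSpace ℝ (Fin n) => |u (embedHyper (n + 1) x)| ^ q) =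
          fun x => ‖f x‖ ^ q := by
        funext x
        rw [hf, s6_embed, Real.norm_eq_abs]
      rw [this]
      exact (Real.continuous_rpow_const hq0.le).comp_aestronglyMeasurable hfm.norm
  rw [hlhs]
  calc _ ≤ (M * ENNReal.ofReal (H1sq (n + 1) R₀ R₁ u) ^ (1 / 2 : ℝ)).toReal :=
        ENNReal.toReal_mono hfin hmain
    _ = M.toReal * √(H1sq (n + 1) R₀ R₁ u) := by
        rw [ENNReal.toReal_mul, ← ENNReal.toReal_rpow, ENNReal.toReal_ofReal hH, Real.sqrt_eq_rpow]
    _ ≤ _ := by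
        gcongr
        linarith

/-- trace estimate on `D = A ∩ {x_N = 0}` for functions in the cone `K`. -/
theorem statement6 (N : ℕ) (hN : 3 ≤ N) (R₀ R₁ : ℝ) (hR₀ : 0 < R₀) (hR : R₀ < R₁) :
    ∀ q : ℝ, 1 ≤ q → ∃ C₁ : ℝ, 0 < C₁ ∧
      ∀ u : EuclideanSpace ℝ (Fin N) → ℝ, memK N R₀ R₁ u →
        (∫ x' in annulus (N - 1) R₀ R₁, |u (embedHyper N x')| ^ q) ^ (1 / q)
          ≤ C₁ * Real.sqrt (H1sq N R₀ R₁ u) := by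
  intro q hq
  obtain ⟨m, rfl⟩ : ∃ m, N = m + 2 + 1 := ⟨N - 3, by omega⟩
  exact s6_main (n := m + 2) R₀ R₁ hR₀ hR q hq
end

section
/- Assume a ∈ K̂ with a > 0 on the closure of A and p > 2. Then there exist α > 0 and ρ > 0 such that: (i) I(u) ≥ 0 for every u ∈ K with ‖u‖_{H¹(A)} < α; (ii) I(u) ≥ ρ for every u ∈ K with ‖u‖_{H¹(A)} = α. -/
open MeasureTheory Real Set

open scoped ENNReal

lemma lintegral_radial {E : Type*} [NormedAddCommGroup E] [NormedSpace ℝ E]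
    [FiniteDimensional ℝ E] [Nontrivial E] [MeasurableSpace E] [BorelSpace E]
    (μ : Measure E) [μ.IsAddHaarMeasure] (f : ℝ → ℝ≥0∞) (hf : Measurable f) :
    ∫⁻ x, f ‖x‖ ∂μ = μ.toSphere univ *
      ∫⁻ y in Ioi (0:ℝ), ENNReal.ofReal (y ^ (Module.finrank ℝ E - 1)) * f y := by
  calc
    ∫⁻ x, f ‖x‖ ∂μ = ∫⁻ x : ({(0)}ᶜ : Set E), f (‖x.1‖) ∂(μ.comap (↑)) := by
      rw [lintegral_subtype_comap (measurableSet_singleton _).compl (fun x ↦ f (‖x‖)),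
        restrict_compl_singleton]
    _ = ∫⁻ x, f x.2 ∂μ.toSphere.prod (.volumeIoiPow (Module.finrank ℝ E - 1)) := by
      simpa using μ.measurePreserving_homeomorphUnitSphereProd.lintegral_comp_emb
        (Homeomorph.measurableEmbedding _) (f ∘ Subtype.val ∘ Prod.snd)
    _ = μ.toSphere univ * ∫⁻ x : Ioi (0 : ℝ), f x ∂.volumeIoiPow (Module.finrank ℝ E - 1) := by
      rw [lintegral_prod _ (by fun_prop)]
      simp [mul_comm]
    _ = _ := by
      rw [Measure.volumeIoiPow, lintegral_withDensity_eq_lintegral_mul _ (by fun_prop)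
        (by fun_prop)]
      congr 1
      exact lintegral_subtype_comap measurableSet_Ioi
        (fun a : ℝ ↦ ENNReal.ofReal (a ^ (Module.finrank ℝ E - 1)) * f a)

lemma lintegral_cyl (n : ℕ) (hn : 2 ≤ n) (G : ℝ × ℝ → ℝ≥0∞) (hG : Measurable G) :
    ∫⁻ x : EuclideanSpace ℝ (Fin (n+1)), G (√(‖x‖^2 - (x (Fin.last n))^2), x (Fin.last n)) =
    (volume : Measure (EuclideanSpace ℝ (Fin n))).toSphere univ *
      ∫⁻ z : ℝ × ℝ, (Ioi (0:ℝ)).indicator (fun s => ENNReal.ofReal (s^(n-1)) * G (s, z.2)) z.1 := by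
  have : Nonempty (Fin n) := ⟨⟨0, by omega⟩⟩
  have h1 := (PiLp.volume_preserving_toLp (Fin (n+1))).lintegral_comp_emb
    (MeasurableEquiv.toLp 2 (Fin (n+1) → ℝ)).measurableEmbedding
    (fun x : EuclideanSpace ℝ (Fin (n+1)) => G (√(‖x‖^2 - (x (Fin.last n))^2), x (Fin.last n)))
  rw [← h1]
  have h2 := (volume_preserving_piFinSuccAbove (fun _ : Fin (n+1) => ℝ) (Fin.last n)).symm.lintegral_comp_emb
    (MeasurableEquiv.piFinSuccAbove (fun _ : Fin (n+1) => ℝ) (Fin.last n)).symm.measurableEmbedding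
    (fun x : Fin (n+1) → ℝ => G (√(‖WithLp.toLp 2 x‖^2 - (x (Fin.last n))^2), x (Fin.last n)))
  rw [← h2]
  have h3 : ∀ z : ℝ × (Fin n → ℝ),
      ‖WithLp.toLp 2 ((MeasurableEquiv.piFinSuccAbove (fun _ : Fin (n+1) => ℝ) (Fin.last n)).symm z)‖^2
       - z.1^2 = ‖WithLp.toLp 2 z.2‖^2 := by
    intro z
    rw [EuclideanSpace.norm_sq_eq, EuclideanSpace.norm_sq_eq, Fin.sum_univ_castSucc]
    simp [MeasurableEquiv.piFinSuccAbove]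
  have h4 : ∀ z : ℝ × (Fin n → ℝ),
      (MeasurableEquiv.piFinSuccAbove (fun _ : Fin (n+1) => ℝ) (Fin.last n)).symm z (Fin.last n) = z.1 := by
    intro z; simp [MeasurableEquiv.piFinSuccAbove]
  simp only [h4, h3, Real.sqrt_sq (norm_nonneg _)]
  have h5 : Measurable fun z : ℝ × (Fin n → ℝ) => G (‖WithLp.toLp 2 z.2‖, z.1) := by
    apply hG.comp
    fun_prop
  rw [Measure.volume_eq_prod, lintegral_prod _ h5.aemeasurable]
  have h6 : ∀ t : ℝ, ∫⁻ y : Fin n → ℝ, G (‖WithLp.toLp 2 y‖, t) =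
      (volume : Measure (EuclideanSpace ℝ (Fin n))).toSphere univ *
      ∫⁻ s in Ioi (0:ℝ), ENNReal.ofReal (s^(n-1)) * G (s, t) := by
    intro t
    have := (PiLp.volume_preserving_toLp (Fin n)).lintegral_comp_emb
      (MeasurableEquiv.toLp 2 (Fin n → ℝ)).measurableEmbedding
      (fun y : EuclideanSpace ℝ (Fin n) => G (‖y‖, t))
    rw [this, lintegral_radial volume (fun s => G (s,t)) (by fun_prop)]
    simp
  simp only [h6]
  have h7 : Measurable fun z : ℝ × ℝ =>
      (Ioi (0:ℝ)).indicator (fun s => ENNReal.ofReal (s^(n-1)) * G (s, z.2)) z.1 := by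
    have : (fun z : ℝ × ℝ =>
      (Ioi (0:ℝ)).indicator (fun s => ENNReal.ofReal (s^(n-1)) * G (s, z.2)) z.1) =
      (Prod.fst ⁻¹' (Ioi (0:ℝ))).indicator
        (fun z : ℝ × ℝ => ENNReal.ofReal (z.1^(n-1)) * G (z.1, z.2)) := by
      ext z; simp [indicator]
    rw [this]
    exact Measurable.indicator (by fun_prop) (measurable_fst measurableSet_Ioi)
  rw [Measure.volume_eq_prod, lintegral_prod_symm _ h7.aemeasurable]
  simp only [lintegral_indicator measurableSet_Ioi]
  rw [lintegral_const_mul' _ _ (measure_ne_top _ _)]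

/-- weight -/
noncomputable def wt (n : ℕ) (z : ℝ × ℝ) : ℝ := z.1 ^ n * (cos z.2) ^ (n-1)

lemma lintegral_polar (n : ℕ) (hn : 2 ≤ n) (F : ℝ × ℝ → ℝ≥0∞) (hF : Measurable F) :
    ∫⁻ x : EuclideanSpace ℝ (Fin (n+1)), F (‖x‖, angleOf x) =
    (volume : Measure (EuclideanSpace ℝ (Fin n))).toSphere univ *
      ∫⁻ z in Ioi (0:ℝ) ×ˢ Ioo (-(π/2)) (π/2), ENNReal.ofReal (wt n z) * F z := by
  have h0 : ∀ x : EuclideanSpace ℝ (Fin (n+1)), lastCoord x = x (Fin.last n) := by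
    intro x; simp [lastCoord]; rfl
  have h1 := lintegral_cyl n hn
    (fun q => F (√(q.1^2+q.2^2), arcsin (q.2 / √(q.1^2+q.2^2)))) (by fun_prop)
  have h2 : ∀ x : EuclideanSpace ℝ (Fin (n+1)), 
      √(√(‖x‖^2 - (x (Fin.last n))^2)^2 + (x (Fin.last n))^2) = ‖x‖ := by
    intro x
    rw [Real.sq_sqrt, sub_add_cancel, Real.sqrt_sq (norm_nonneg _)]
    have := PiLp.norm_apply_le x (Fin.last n)
    rw [Real.norm_eq_abs] at this
    have := pow_le_pow_left₀ (abs_nonneg _) this 2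
    rw [sq_abs] at this
    linarith
  simp only [h2] at h1
  simp only [angleOf, h0]
  rw [h1, ← lintegral_comp_polarCoord_symm]
  congr 1
  have hsub : Ioi (0:ℝ) ×ˢ Ioo (-(π/2)) (π/2) ⊆ polarCoord.target := by
    rw [polarCoord_target]
    refine prod_mono le_rfl (Ioo_subset_Ioo ?_ ?_) <;> linarith [pi_pos]
  rw [← inter_eq_self_of_subset_left hsub, ← Measure.restrict_restrict
    (measurableSet_Ioi.prod measurableSet_Ioo), ← lintegral_indicator
    (measurableSet_Ioi.prod measurableSet_Ioo)]
  refine setLIntegral_congr_fun (by rw [polarCoord_target]; exact measurableSet_Ioi.prod measurableSet_Ioo) ?_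
  rintro ⟨r, θ⟩ hz
  rw [polarCoord_target] at hz
  obtain ⟨hr, hθ⟩ := hz
  simp only [mem_Ioi, mem_Ioo] at hr hθ
  have hr2 : √((r * cos θ)^2 + (r * sin θ)^2) = r := by
    rw [show (r * cos θ)^2 + (r * sin θ)^2 = r^2 * (sin θ^2 + cos θ^2) by ring,
      sin_sq_add_cos_sq, mul_one, Real.sqrt_sq hr.le]
  simp only [polarCoord_symm_apply]
  by_cases hθ2 : θ ∈ Ioo (-(π/2)) (π/2)
  · have hc : 0 < cos θ := cos_pos_of_mem_Ioo hθ2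
    rw [indicator_of_mem (show r * cos θ ∈ Ioi (0:ℝ) from mul_pos hr hc),
      indicator_of_mem (show (r,θ) ∈ Ioi (0:ℝ) ×ˢ Ioo (-(π/2)) (π/2) from ⟨hr, hθ2⟩)]
    rw [hr2, mul_div_cancel_left₀ _ hr.ne', arcsin_sin hθ2.1.le hθ2.2.le, smul_eq_mul, ← mul_assoc,
      ← ENNReal.ofReal_mul hr.le, wt, mul_pow, ← mul_assoc, ← pow_succ',
      show n - 1 + 1 = n by omega]
  · have hc : cos θ ≤ 0 := by
      simp only [mem_Ioo, not_and_or, not_lt] at hθ2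
      rcases hθ2 with h | h
      · rw [← cos_neg]; apply cos_nonpos_of_pi_div_two_le_of_le <;> linarith
      · apply cos_nonpos_of_pi_div_two_le_of_le <;> linarith
    rw [indicator_of_notMem (show r * cos θ ∉ Ioi (0:ℝ) by simp; exact mul_nonpos_of_nonneg_of_nonpos hr.le hc),
      indicator_of_notMem (fun h => hθ2 h.2), smul_zero]

lemma ftc_bound {a b : ℝ} (f f' : ℝ → ℝ) (hf : Continuous f) (hf' : Continuous f')
    (hd : ∀ x ∈ Ioo a b, HasDerivAt f (f' x) x) {x y : ℝ} (hx : x ∈ Icc a b) (hy : y ∈ Icc a b) :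
    f x - f y ≤ ∫ t in Icc a b, |f' t| := by
  have h := intervalIntegral.integral_eq_sub_of_hasDeriv_right (a := y) (b := x) (f := f) (f' := f')
    hf.continuousOn (fun t ht => (hd t ⟨(le_min hy.1 hx.1).trans_lt ht.1,
      ht.2.trans_le (max_le hy.2 hx.2)⟩).hasDerivWithinAt) (hf'.intervalIntegrable _ _)
  rw [← h]
  refine (le_abs_self _).trans ?_
  rw [← Real.norm_eq_abs]
  refine (intervalIntegral.norm_integral_le_integral_norm_uIoc).trans ?_
  refine setIntegral_mono_set (hf'.abs.continuousOn.integrableOn_compact isCompact_Icc)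
    (Filter.Eventually.of_forall fun t => abs_nonneg _) (Filter.Eventually.of_forall ?_)
  intro t ht
  exact uIcc_subset_Icc hy hx (uIoc_subset_uIcc ht)

lemma cs_cont {K : Set (ℝ × ℝ)} (hK : IsCompact K) (f g : ℝ × ℝ → ℝ) (hf : Continuous f)
    (hg : Continuous g) :
    (∫ z in K, f z * g z)^2 ≤ (∫ z in K, f z ^ 2) * ∫ z in K, g z ^ 2 := by
  have i1 : IntegrableOn (fun z => f z ^ 2) K := (hf.pow 2).continuousOn.integrableOn_compact hK
  have i2 : IntegrableOn (fun z => g z ^ 2) K := (hg.pow 2).continuousOn.integrableOn_compact hK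
  have i3 : IntegrableOn (fun z => f z * g z) K := (hf.mul hg).continuousOn.integrableOn_compact hK
  have key : ∀ t : ℝ, 0 ≤ (∫ z in K, f z ^ 2) * (t * t) + (2 * ∫ z in K, f z * g z) * t
      + ∫ z in K, g z ^ 2 := by
    intro t
    have : (∫ z in K, f z ^ 2) * (t * t) + (2 * ∫ z in K, f z * g z) * t
      + ∫ z in K, g z ^ 2 = ∫ z in K, (t * f z + g z)^2 := by
      have e : (fun z => (t * f z + g z)^2) =
        fun z => ((t*t) * f z ^ 2 + (2 * t) * (f z * g z)) + g z ^ 2 := by ext z; ring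
      have i4 : IntegrableOn (fun z => (t*t) * f z ^ 2 + (2 * t) * (f z * g z)) K :=
        (i1.const_mul _).add (i3.const_mul _)
      rw [e, integral_add i4 i2, integral_add (i1.const_mul _) (i3.const_mul _), integral_const_mul, integral_const_mul]
      ring
    rw [this]
    exact integral_nonneg fun z => sq_nonneg _
  have := discrim_le_zero key
  rw [discrim] at this
  nlinarith

lemma step2D {a b T : ℝ} (hab : a < b) (hT : 0 < T) (V P Q : ℝ × ℝ → ℝ) (hVc : Continuous V)
    (hPc : Continuous P) (hQc : Continuous Q) (hV : ∀ z, 0 ≤ V z) (hV0 : ∀ θ, V (a, θ) = 0)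
    (hP : ∀ r ∈ Ioo a b, ∀ θ, HasDerivAt (fun s => V (s, θ)) (P (r, θ)) r)
    (hQ : ∀ r θ, HasDerivAt (fun φ => V (r, φ)) (Q (r, θ)) θ) (k : ℕ) :
    ∫ z in Icc a b ×ˢ Icc 0 T, V z ^ (2 * (k+1)) ≤
      ((k+1) * (1/T + (k+1))) * (∫ z in Icc a b ×ˢ Icc 0 T, V z ^ (2 * k)) *
      (∫ z in Icc a b ×ˢ Icc 0 T, (V z ^ 2 + P z ^ 2 + Q z ^ 2)) := by
  set D := Icc a b ×ˢ Icc 0 T with hD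
  have hDc : IsCompact D := isCompact_Icc.prod isCompact_Icc
  have io : ∀ f : ℝ × ℝ → ℝ, Continuous f → IntegrableOn f D :=
    fun f hf => hf.continuousOn.integrableOn_compact hDc
  set Φ : ℝ → ℝ := fun θ => ∫ s in Icc a b, |(k+1) * V (s, θ)^k * P (s, θ)| with hΦ
  set J : ℝ → ℝ := fun r => ∫ φ in Icc 0 T, |(k+1) * V (r, φ)^k * Q (r, φ)| with hJ
  set M : ℝ → ℝ := fun r => ∫ φ in Icc 0 T, V (r, φ)^(k+1) with hM
  have hΦb : ∀ r ∈ Icc a b, ∀ θ, V (r, θ)^(k+1) ≤ Φ θ := by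
    intro r hr θ
    have := ftc_bound (a := a) (b := b) (fun s => V (s, θ)^(k+1))
      (fun s => (k+1) * V (s, θ)^k * P (s, θ)) (by fun_prop) (by fun_prop)
      (fun x hx => by simpa using (hP x hx θ).fun_pow (k+1)) hr (left_mem_Icc.2 hab.le)
    simpa only [hV0, zero_pow (Nat.succ_ne_zero k), sub_zero] using this
  have hΨb : ∀ r, ∀ θ ∈ Icc 0 T, V (r, θ)^(k+1) ≤ (1/T) * M r + J r := by
    intro r θ hθ
    have h1 : ∀ φ ∈ Icc 0 T, V (r, θ)^(k+1) - J r ≤ V (r, φ)^(k+1) := by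
      intro φ hφ
      have := ftc_bound (a := 0) (b := T) (fun s => V (r, s)^(k+1))
        (fun s => (k+1) * V (r, s)^k * Q (r, s)) (by fun_prop) (by fun_prop)
        (fun x hx => by simpa using (hQ r x).fun_pow (k+1)) hθ hφ
      simp only [hJ]
      linarith
    have h2 : ∫ φ in Icc 0 T, (V (r, θ)^(k+1) - J r) ≤ M r :=
      setIntegral_mono_on (by simp) ((by fun_prop : Continuous fun φ => V (r, φ)^(k+1)).continuousOn.integrableOn_compact isCompact_Icc)
        measurableSet_Icc h1
    rw [setIntegral_const] at h2
    simp [hT.le] at h2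
    have h3 : (1/T) * (T * (V (r, θ)^(k+1) - J r)) ≤ (1/T) * M r :=
      mul_le_mul_of_nonneg_left h2 (by positivity)
    rw [← mul_assoc, one_div_mul_cancel hT.ne', one_mul] at h3
    linarith
  -- Fubini identities
  have fub : ∀ f : ℝ × ℝ → ℝ, Continuous f →
      ∫ z in D, f z = ∫ r in Icc a b, ∫ θ in Icc 0 T, f (r, θ) := by
    intro f hf
    have := setIntegral_prod (μ := volume) (ν := volume) f (s := Icc a b) (t := Icc 0 T) (io f hf)
    exact this
  have fub' : ∀ f : ℝ × ℝ → ℝ, Continuous f →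
      ∫ z in D, f z = ∫ θ in Icc 0 T, ∫ r in Icc a b, f (r, θ) := by
    intro f hf
    have h1 := integral_prod_symm (μ := volume.restrict (Icc a b)) (ν := volume.restrict (Icc 0 T)) f
      (by rw [Measure.prod_restrict]; exact io f hf)
    rw [Measure.prod_restrict] at h1
    exact h1
  have intg : ∀ f : ℝ × ℝ → ℝ, Continuous f →
      IntegrableOn (fun r => ∫ θ in Icc 0 T, f (r, θ)) (Icc a b) := by
    intro f hf
    have h : Integrable f ((volume.restrict (Icc a b)).prod (volume.restrict (Icc 0 T))) := by
      rw [Measure.prod_restrict]; exact io f hf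
    exact h.integral_prod_left
  have intg' : ∀ f : ℝ × ℝ → ℝ, Continuous f →
      IntegrableOn (fun θ => ∫ r in Icc a b, f (r, θ)) (Icc 0 T) := by
    intro f hf
    have h : Integrable f ((volume.restrict (Icc a b)).prod (volume.restrict (Icc 0 T))) := by
      rw [Measure.prod_restrict]; exact io f hf
    exact h.integral_prod_right
  set X := ∫ z in D, V z ^ (2 * k) with hX
  set S := ∫ z in D, (V z ^ 2 + P z ^ 2 + Q z ^ 2) with hS
  have X0 : 0 ≤ X := integral_nonneg fun z => by rw [pow_mul]; positivity
  have S0 : 0 ≤ S := integral_nonneg fun z => by positivity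
  have cs : ∀ g : ℝ × ℝ → ℝ, Continuous g → (∀ z, g z ^ 2 ≤ V z ^ 2 + P z ^ 2 + Q z ^ 2) →
      ∫ z in D, V z ^ k * g z ≤ √(X * S) := by
    intro g hg hgS
    apply Real.le_sqrt_of_sq_le
    refine (cs_cont hDc (fun z => V z ^ k) g (hVc.pow k) hg).trans ?_
    have e : ∫ z in D, (V z ^ k) ^ 2 = X := by simp only [hX, ← pow_mul, mul_comm]
    rw [e]
    refine mul_le_mul_of_nonneg_left ?_ X0
    exact setIntegral_mono (io _ (by fun_prop)) (io _ (by fun_prop)) hgS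
  have hk : (0:ℝ) ≤ k + 1 := by positivity
  have i1 : ∫ θ in Icc 0 T, Φ θ ≤ (k+1) * √(X * S) := by
    rw [hΦ, ← fub' (fun z => |(k+1) * V z^k * P z|) (by fun_prop)]
    have : ∀ z, |(k+1) * V z^k * P z| = (k+1) * (V z ^ k * |P z|) := by
      intro z
      rw [abs_mul, abs_of_nonneg (mul_nonneg hk (pow_nonneg (hV z) k)), mul_assoc]
    simp only [this]
    rw [integral_const_mul]
    refine mul_le_mul_of_nonneg_left (cs _ (by fun_prop) ?_) hk
    intro z; rw [sq_abs]; nlinarith [sq_nonneg (V z), sq_nonneg (Q z)]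
  have i2 : ∫ r in Icc a b, J r ≤ (k+1) * √(X * S) := by
    rw [hJ, ← fub (fun z => |(k+1) * V z^k * Q z|) (by fun_prop)]
    have : ∀ z, |(k+1) * V z^k * Q z| = (k+1) * (V z ^ k * |Q z|) := by
      intro z
      rw [abs_mul, abs_of_nonneg (mul_nonneg hk (pow_nonneg (hV z) k)), mul_assoc]
    simp only [this]
    rw [integral_const_mul]
    refine mul_le_mul_of_nonneg_left (cs _ (by fun_prop) ?_) hk
    intro z; rw [sq_abs]; nlinarith [sq_nonneg (V z), sq_nonneg (P z)]
  have i3 : ∫ r in Icc a b, M r ≤ √(X * S) := by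
    rw [hM, ← fub (fun z => V z^(k+1)) (by fun_prop)]
    simp only [pow_succ]
    refine cs _ hVc ?_
    intro z; nlinarith [sq_nonneg (Q z), sq_nonneg (P z)]
  have jM : IntegrableOn M (Icc a b) := intg (fun z => V z^(k+1)) (by fun_prop)
  have jJ : IntegrableOn J (Icc a b) := intg (fun z => |(k+1) * V z^k * Q z|) (by fun_prop)
  have jΦ : IntegrableOn Φ (Icc 0 T) := intg' (fun z => |(k+1) * V z^k * P z|) (by fun_prop)
  have jΨ : IntegrableOn (fun r => (1/T) * M r + J r) (Icc a b) := (jM.const_mul _).add jJ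
  have i4 : ∫ r in Icc a b, ((1/T) * M r + J r) ≤ (1/T + (k+1)) * √(X * S) := by
    rw [integral_add (jM.const_mul _) jJ, integral_const_mul, add_mul]
    exact add_le_add (mul_le_mul_of_nonneg_left i3 (by positivity)) i2
  have main : ∫ z in D, V z ^ (2 * (k+1)) ≤
      (∫ r in Icc a b, ((1/T) * M r + J r)) * ∫ θ in Icc 0 T, Φ θ := by
    have e := setIntegral_prod_mul (μ := volume) (ν := volume) (fun r => (1/T) * M r + J r) Φ
      (Icc a b) (Icc 0 T)
    rw [← e]
    refine setIntegral_mono_on (io _ (by fun_prop)) ?_ (measurableSet_Icc.prod measurableSet_Icc) ?_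
    · have := Integrable.mul_prod jΨ jΦ
      rw [Measure.prod_restrict] at this
      exact this
    · rintro ⟨r, θ⟩ ⟨hr, hθ⟩
      rw [two_mul, pow_add]
      have hh := pow_nonneg (hV (r, θ)) (k+1)
      exact mul_le_mul (hΨb r θ hθ) (hΦb r hr θ) hh (hh.trans (hΨb r θ hθ))
  have Φ0 : 0 ≤ ∫ θ in Icc 0 T, Φ θ := integral_nonneg fun θ => integral_nonneg fun s => abs_nonneg _
  calc _ ≤ _ := main
    _ ≤ ((1/T + (k+1)) * √(X * S)) * ((k+1) * √(X * S)) :=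
      mul_le_mul i4 i1 Φ0 (by positivity)
    _ = ((k+1) * (1/T + (k+1))) * (√(X * S) * √(X * S)) := by ring
    _ = _ := by rw [Real.mul_self_sqrt (mul_nonneg X0 S0)]; ring

lemma sob2D (T : ℝ) (hT : 0 < T) (k : ℕ) : ∃ C : ℝ, 0 ≤ C ∧
    ∀ (a b : ℝ) (_ : a < b) (V P Q : ℝ × ℝ → ℝ) (_ : Continuous V)
    (_ : Continuous P) (_ : Continuous Q) (_ : ∀ z, 0 ≤ V z) (_ : ∀ θ, V (a, θ) = 0)
    (_ : ∀ r ∈ Ioo a b, ∀ θ, HasDerivAt (fun s => V (s, θ)) (P (r, θ)) r)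
    (_ : ∀ r θ, HasDerivAt (fun φ => V (r, φ)) (Q (r, θ)) θ),
    ∫ z in Icc a b ×ˢ Icc 0 T, V z ^ (2 * (k+1)) ≤
      C * (∫ z in Icc a b ×ˢ Icc 0 T, (V z ^ 2 + P z ^ 2 + Q z ^ 2))^(k+1) := by
  induction k with
  | zero =>
    refine ⟨1, zero_le_one, ?_⟩
    intro a b hab V P Q hVc hPc hQc hV hV0 hP hQ
    have io : ∀ f : ℝ × ℝ → ℝ, Continuous f → IntegrableOn f (Icc a b ×ˢ Icc 0 T) :=
      fun f hf => hf.continuousOn.integrableOn_compact (isCompact_Icc.prod isCompact_Icc)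
    simp only [zero_add, mul_one, one_mul, pow_one]
    refine setIntegral_mono (io _ (by fun_prop)) (io _ (by fun_prop)) ?_
    intro z
    simp only
    nlinarith [sq_nonneg (P z), sq_nonneg (Q z)]
  | succ k ih =>
    obtain ⟨C, hC, h⟩ := ih
    refine ⟨((k+1:ℕ)+1) * (1/T + ((k+1:ℕ)+1)) * C, by positivity, ?_⟩
    intro a b hab V P Q hVc hPc hQc hV hV0 hP hQ
    have h1 := step2D hab hT V P Q hVc hPc hQc hV hV0 hP hQ (k+1)
    have h2 := h a b hab V P Q hVc hPc hQc hV hV0 hP hQ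
    set S := ∫ z in Icc a b ×ˢ Icc 0 T, (V z ^ 2 + P z ^ 2 + Q z ^ 2) with hS
    have S0 : 0 ≤ S := integral_nonneg fun z => by positivity
    refine h1.trans ?_
    rw [pow_succ S]
    calc _ ≤ (((k+1:ℕ)+1) * (1/T + ((k+1:ℕ)+1))) * (C * S^(k+1)) * S := by gcongr
      _ = _ := by ring

lemma ball_in_annulus {N : ℕ} {R₀ R₁ : ℝ} (hR₀ : 0 < R₀) (hR : R₀ < R₁)
    {x : EuclideanSpace ℝ (Fin N)} (hx : R₀ ≤ ‖x‖ ∧ ‖x‖ ≤ R₁) :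
    ∃ c : EuclideanSpace ℝ (Fin N), x ∈ Metric.closedBall c ((R₁ - R₀)/2) ∧
      Metric.ball c ((R₁ - R₀)/2) ⊆ annulus N R₀ R₁ := by
  have hx0 : 0 < ‖x‖ := hR₀.trans_le hx.1
  refine ⟨((R₀ + R₁)/(2 * ‖x‖)) • x, ?_, ?_⟩
  · rw [Metric.mem_closedBall, dist_eq_norm]
    have : x - ((R₀ + R₁)/(2 * ‖x‖)) • x = (1 - (R₀ + R₁)/(2 * ‖x‖)) • x := by
      rw [sub_smul, one_smul]
    rw [this, norm_smul, Real.norm_eq_abs, ← abs_of_pos hx0, ← abs_mul, abs_of_pos hx0]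
    have : (1 - (R₀ + R₁)/(2 * ‖x‖)) * ‖x‖ = ‖x‖ - (R₀ + R₁)/2 := by field_simp
    rw [this, abs_le]
    constructor <;> linarith [hx.1, hx.2]
  · intro y hy
    rw [Metric.mem_ball, dist_eq_norm] at hy
    have hc : ‖((R₀ + R₁)/(2 * ‖x‖)) • x‖ = (R₀ + R₁)/2 := by
      rw [norm_smul, Real.norm_eq_abs, abs_of_nonneg (by have := hR₀.trans hR; positivity)]
      field_simp
    have h1 := (abs_norm_sub_norm_le y (((R₀ + R₁)/(2 * ‖x‖)) • x)).trans_lt hy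
    rw [hc, abs_lt] at h1
    constructor <;> linarith [h1.1, h1.2]

lemma closure_annulus {N : ℕ} {R₀ R₁ : ℝ} (hR₀ : 0 < R₀) (hR : R₀ < R₁) :
    closure (annulus N R₀ R₁) = {x | R₀ ≤ ‖x‖ ∧ ‖x‖ ≤ R₁} := by
  apply Subset.antisymm
  · apply closure_minimal
    · intro x hx; exact ⟨hx.1.le, hx.2.le⟩
    · exact (isClosed_le continuous_const continuous_norm).inter
        (isClosed_le continuous_norm continuous_const)
  · intro x hx
    obtain ⟨c, h1, h2⟩ := ball_in_annulus hR₀ hR hx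
    rw [← closure_ball c (by linarith : (R₁ - R₀)/2 ≠ 0)] at h1
    exact closure_mono h2 h1

lemma uniqueDiff_annulus {N : ℕ} {R₀ R₁ : ℝ} (hR₀ : 0 < R₀) (hR : R₀ < R₁) :
    UniqueDiffOn ℝ (closure (annulus N R₀ R₁)) := by
  intro x hx
  rw [closure_annulus hR₀ hR] at hx
  obtain ⟨c, h1, h2⟩ := ball_in_annulus hR₀ hR hx
  have hr : (R₁ - R₀)/2 ≠ 0 := by linarith
  have : UniqueDiffWithinAt ℝ (Metric.closedBall c ((R₁ - R₀)/2)) x :=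
    uniqueDiffWithinAt_convex (convex_closedBall _ _)
      (by rw [interior_closedBall _ hr]; exact ⟨c, Metric.mem_ball_self (by linarith)⟩)
      (subset_closure h1)
  refine this.mono ?_
  rw [← closure_ball c hr]
  exact closure_mono h2

lemma isOpen_annulus {N : ℕ} {R₀ R₁ : ℝ} : IsOpen (annulus N R₀ R₁) :=
  (isOpen_lt continuous_const continuous_norm).inter
    (isOpen_lt continuous_norm continuous_const)

lemma isCompact_annulus {N : ℕ} {R₀ R₁ : ℝ} (hR₀ : 0 < R₀) (hR : R₀ < R₁) :
    IsCompact (closure (annulus N R₀ R₁)) := by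
  refine Metric.isCompact_of_isClosed_isBounded isClosed_closure ?_
  rw [closure_annulus hR₀ hR]
  refine (Metric.isBounded_closedBall (x := (0 : EuclideanSpace ℝ (Fin N))) (r := R₁)).subset ?_
  intro x hx
  simpa using hx.2

/-- last unit vector -/
noncomputable def eLast (n : ℕ) : EuclideanSpace ℝ (Fin (n+1)) :=
  EuclideanSpace.single (Fin.last n) 1

/-- direction -/
noncomputable def dir {n : ℕ} (e : EuclideanSpace ℝ (Fin (n+1))) (θ : ℝ) :
    EuclideanSpace ℝ (Fin (n+1)) := cos θ • e + sin θ • eLast n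

/-- angular direction -/
noncomputable def dir' {n : ℕ} (e : EuclideanSpace ℝ (Fin (n+1))) (θ : ℝ) :
    EuclideanSpace ℝ (Fin (n+1)) := (-sin θ) • e + cos θ • eLast n

lemma lastCoord_eq {n : ℕ} (x : EuclideanSpace ℝ (Fin (n+1))) :
    lastCoord x = x (Fin.last n) := by
  simp [lastCoord]; rfl

lemma inner_eLast {n : ℕ} (x : EuclideanSpace ℝ (Fin (n+1))) :
    inner ℝ x (eLast n) = x (Fin.last n) := by
  rw [eLast, EuclideanSpace.inner_single_right]; simp

lemma norm_eLast (n : ℕ) : ‖eLast n‖ = 1 := by simp [eLast]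

lemma norm_comb {n : ℕ} (e : EuclideanSpace ℝ (Fin (n+1))) (he : ‖e‖ = 1)
    (he0 : e (Fin.last n) = 0) (s t : ℝ) : ‖s • e + t • eLast n‖ ^ 2 = s^2 + t^2 := by
  rw [norm_add_sq_real, norm_smul, norm_smul, inner_smul_left, inner_smul_right, inner_eLast, he0, he,
    norm_eLast]
  simp

lemma norm_dir {n : ℕ} (e : EuclideanSpace ℝ (Fin (n+1))) (he : ‖e‖ = 1)
    (he0 : e (Fin.last n) = 0) (θ : ℝ) : ‖dir e θ‖ = 1 := by
  have := norm_comb e he he0 (cos θ) (sin θ)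
  rw [cos_sq_add_sin_sq] at this
  exact (pow_eq_one_iff_of_nonneg (norm_nonneg _) two_ne_zero).1 this

lemma norm_dir' {n : ℕ} (e : EuclideanSpace ℝ (Fin (n+1))) (he : ‖e‖ = 1)
    (he0 : e (Fin.last n) = 0) (θ : ℝ) : ‖dir' e θ‖ = 1 := by
  have := norm_comb e he he0 (-sin θ) (cos θ)
  rw [neg_sq, sin_sq_add_cos_sq] at this
  exact (pow_eq_one_iff_of_nonneg (norm_nonneg _) two_ne_zero).1 this

lemma norm_pt {n : ℕ} (e : EuclideanSpace ℝ (Fin (n+1))) (he : ‖e‖ = 1)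
    (he0 : e (Fin.last n) = 0) {r : ℝ} (hr : 0 < r) (θ : ℝ) : ‖r • dir e θ‖ = r := by
  rw [norm_smul, norm_dir e he he0, mul_one, Real.norm_eq_abs, abs_of_pos hr]

lemma angle_pt {n : ℕ} (e : EuclideanSpace ℝ (Fin (n+1))) (he : ‖e‖ = 1)
    (he0 : e (Fin.last n) = 0) {r : ℝ} (hr : 0 < r) {θ : ℝ} (hθ : θ ∈ Icc (-(π/2)) (π/2)) :
    angleOf (r • dir e θ) = θ := by
  rw [angleOf, norm_pt e he he0 hr, lastCoord_eq]
  have : (r • dir e θ) (Fin.last n) = r * sin θ := by simp [dir, he0, eLast]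
  rw [this, mul_div_cancel_left₀ _ hr.ne', arcsin_sin hθ.1 hθ.2]

lemma pt_mem {n : ℕ} {R₀ R₁ : ℝ} (hR₀ : 0 < R₀) (hR : R₀ < R₁)
    (e : EuclideanSpace ℝ (Fin (n+1))) (he : ‖e‖ = 1)
    (he0 : e (Fin.last n) = 0) {r : ℝ} (hr : r ∈ Icc R₀ R₁) (θ : ℝ) :
    r • dir e θ ∈ closure (annulus (n+1) R₀ R₁) := by
  rw [closure_annulus hR₀ hR, mem_ofPred_eq, norm_pt e he he0 (hR₀.trans_le hr.1)]
  exact hr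

lemma decomp {n : ℕ} (x : EuclideanSpace ℝ (Fin (n+1))) (hx : 0 < ‖x‖)
    (hθ : angleOf x ∈ Ioo (-(π/2)) (π/2)) :
    ∃ e : EuclideanSpace ℝ (Fin (n+1)), ‖e‖ = 1 ∧ e (Fin.last n) = 0 ∧
      x = ‖x‖ • dir e (angleOf x) := by
  set θ := angleOf x with hθd
  have hc : 0 < cos θ := cos_pos_of_mem_Ioo hθ
  have habs : |x (Fin.last n)| ≤ ‖x‖ := by
    have := PiLp.norm_apply_le x (Fin.last n)
    rwa [Real.norm_eq_abs] at this
  have hs : ‖x‖ * sin θ = x (Fin.last n) := by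
    rw [hθd, angleOf, lastCoord_eq, sin_arcsin, mul_div_cancel₀ _ hx.ne']
    · rw [le_div_iff₀ hx]; linarith [(abs_le.1 habs).1]
    · rw [div_le_iff₀ hx]; linarith [(abs_le.1 habs).2]
  set y := x - (x (Fin.last n)) • eLast n with hy
  have hyn : ‖y‖^2 = (‖x‖ * cos θ)^2 := by
    have : (‖x‖ * cos θ)^2 = ‖x‖^2 - (‖x‖ * sin θ)^2 := by
      rw [mul_pow, mul_pow, cos_sq']; ring
    rw [this, hs, hy, norm_sub_sq_real, norm_smul, inner_smul_right, inner_eLast, norm_eLast,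
      mul_one, Real.norm_eq_abs, sq_abs]
    ring
  have hyn' : ‖y‖ = ‖x‖ * cos θ := by
    rwa [sq_eq_sq₀ (norm_nonneg _) (by positivity)] at hyn
  refine ⟨(‖x‖ * cos θ)⁻¹ • y, ?_, ?_, ?_⟩
  · rw [norm_smul, hyn', norm_inv, Real.norm_eq_abs, abs_of_pos (by positivity)]
    exact inv_mul_cancel₀ (by positivity)
  · simp [hy, eLast]
  · rw [dir, smul_add, smul_smul, smul_smul, smul_smul, hs,
      mul_inv_cancel₀ (by positivity), one_smul, hy, sub_add_cancel]

section deriv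
variable {n : ℕ} {R₀ R₁ : ℝ} {u : EuclideanSpace ℝ (Fin (n+1)) → ℝ}

lemma deriv_r (hR₀ : 0 < R₀) (hR : R₀ < R₁)
    (hu : ContDiffOn ℝ 1 u (closure (annulus (n+1) R₀ R₁)))
    (e : EuclideanSpace ℝ (Fin (n+1))) (he : ‖e‖ = 1)
    (he0 : e (Fin.last n) = 0) {r : ℝ} (hr : r ∈ Ioo R₀ R₁) (θ : ℝ) :
    HasDerivAt (fun s => u (s • dir e θ))
      (fderivWithin ℝ u (closure (annulus (n+1) R₀ R₁)) (r • dir e θ) (dir e θ)) r := by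
  have hm := pt_mem hR₀ hR e he he0 (Ioo_subset_Icc_self hr) θ
  have h1 := (hu.differentiableOn one_ne_zero _ hm).hasFDerivWithinAt
  have h2 : HasDerivAt (fun s : ℝ => s • dir e θ) (dir e θ) r := by
    simpa using (hasDerivAt_id r).smul_const (dir e θ)
  refine HasFDerivWithinAt.comp_hasDerivAt r h1 h2 ?_
  filter_upwards [isOpen_Ioo.mem_nhds hr] with s hs
  exact pt_mem hR₀ hR e he he0 (Ioo_subset_Icc_self hs) θ

lemma deriv_th (hR₀ : 0 < R₀) (hR : R₀ < R₁)
    (hu : ContDiffOn ℝ 1 u (closure (annulus (n+1) R₀ R₁)))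
    (e : EuclideanSpace ℝ (Fin (n+1))) (he : ‖e‖ = 1)
    (he0 : e (Fin.last n) = 0) {r : ℝ} (hr : r ∈ Icc R₀ R₁) (θ : ℝ) :
    HasDerivAt (fun φ => u (r • dir e φ))
      (fderivWithin ℝ u (closure (annulus (n+1) R₀ R₁)) (r • dir e θ) (r • dir' e θ)) θ := by
  have hm := pt_mem hR₀ hR e he he0 hr θ
  have h1 := (hu.differentiableOn one_ne_zero _ hm).hasFDerivWithinAt
  have h2 : HasDerivAt (fun φ : ℝ => r • dir e φ) (r • dir' e θ) θ :=
    (((hasDerivAt_cos θ).smul_const e).add ((hasDerivAt_sin θ).smul_const (eLast n))).const_smul r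
  refine HasFDerivWithinAt.comp_hasDerivAt θ h1 h2 ?_
  filter_upwards with s
  exact pt_mem hR₀ hR e he he0 hr s

end deriv

lemma exists_VPQ {n : ℕ} (hn : 2 ≤ n) {R₀ R₁ : ℝ} (hR₀ : 0 < R₀) (hR : R₀ < R₁)
    {u : EuclideanSpace ℝ (Fin (n+1)) → ℝ} (hu : memK (n+1) R₀ R₁ u) :
    ∃ V P Q : ℝ × ℝ → ℝ, Continuous V ∧ Continuous P ∧ Continuous Q ∧ (∀ z, 0 ≤ V z) ∧
      (∀ θ, V (R₀, θ) = 0) ∧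
      (∀ r ∈ Ioo R₀ R₁, ∀ θ, HasDerivAt (fun s => V (s, θ)) (P (r, θ)) r) ∧
      (∀ r θ, HasDerivAt (fun φ => V (r, φ)) (Q (r, θ)) θ) ∧
      (∀ x ∈ annulus (n+1) R₀ R₁, u x = V (‖x‖, angleOf x)) ∧
      (∀ x ∈ annulus (n+1) R₀ R₁, angleOf x ∈ Ioo 0 (π/4) →
        V (‖x‖, angleOf x)^2 + P (‖x‖, angleOf x)^2 + Q (‖x‖, angleOf x)^2 ≤
        (2 + R₁^2) * (‖fderivWithin ℝ u (closure (annulus (n+1) R₀ R₁)) x‖ ^ 2 + (u x) ^ 2)) ∧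
      (∀ r ∈ Icc R₀ R₁, ∀ θ ∈ Icc (-(π/2)) (π/2), V (r, θ) ≤ V (r, |θ|/2)) := by
  obtain ⟨⟨hC, hpos, 𝔲, hrep, heven, hanti⟩, hbd⟩ := hu
  set A := closure (annulus (n+1) R₀ R₁) with hA
  set e : EuclideanSpace ℝ (Fin (n+1)) := EuclideanSpace.single 0 1 with hedef
  have he : ‖e‖ = 1 := by simp [hedef]
  have he0 : e (Fin.last n) = 0 := by
    have : Fin.last n ≠ 0 := by rw [Ne, Fin.last_eq_zero_iff]; omega
    simp [hedef, this]
  set cl : ℝ → ℝ := fun r => max R₀ (min R₁ r) with hcl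
  have hclm : ∀ r, cl r ∈ Icc R₀ R₁ := fun r => ⟨le_max_left _ _, max_le hR.le (min_le_left _ _)⟩
  have hcle : ∀ r ∈ Icc R₀ R₁, cl r = r := fun r hr => by
    simp [hcl, min_eq_right hr.2, max_eq_right hr.1]
  have hclc : Continuous cl := by fun_prop
  have hdc : Continuous (dir e) := by unfold dir; fun_prop
  have hdc' : Continuous (dir' e) := by unfold dir'; fun_prop
  have hptc : Continuous fun z : ℝ × ℝ => cl z.1 • dir e z.2 := by fun_prop
  have hptm : ∀ z : ℝ × ℝ, cl z.1 • dir e z.2 ∈ A := fun z => pt_mem hR₀ hR e he he0 (hclm _) _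
  have hval : ∀ e' : EuclideanSpace ℝ (Fin (n+1)), ‖e'‖ = 1 → e' (Fin.last n) = 0 →
      ∀ r ∈ Icc R₀ R₁, ∀ θ ∈ Icc (-(π/2)) (π/2), u (r • dir e' θ) = 𝔲 r θ := by
    intro e' h1 h2 r hr θ hθ
    rw [hrep _ (pt_mem hR₀ hR e' h1 h2 hr θ), norm_pt e' h1 h2 (hR₀.trans_le hr.1),
      angle_pt e' h1 h2 (hR₀.trans_le hr.1) hθ]
  have hDc : Continuous fun z : ℝ × ℝ => fderivWithin ℝ u A (cl z.1 • dir e z.2) :=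
    (hC.continuousOn_fderivWithin (uniqueDiff_annulus hR₀ hR) le_rfl).comp_continuous hptc hptm
  have hang : ∀ x : EuclideanSpace ℝ (Fin (n+1)), angleOf x ∈ Icc (-(π/2)) (π/2) :=
    fun x => arcsin_mem_Icc _
  have hVval : ∀ x ∈ annulus (n+1) R₀ R₁, u x = u (cl ‖x‖ • dir e (angleOf x)) := by
    intro x hx
    have hx' : ‖x‖ ∈ Icc R₀ R₁ := ⟨hx.1.le, hx.2.le⟩
    rw [hcle _ hx', hval e he he0 _ hx' _ (hang x)]
    exact hrep x (subset_closure hx)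
  refine ⟨fun z => u (cl z.1 • dir e z.2),
    fun z => fderivWithin ℝ u A (cl z.1 • dir e z.2) (dir e z.2),
    fun z => fderivWithin ℝ u A (cl z.1 • dir e z.2) (cl z.1 • dir' e z.2),
    hC.continuousOn.comp_continuous hptc hptm, hDc.clm_apply (by fun_prop),
    hDc.clm_apply (by fun_prop), fun z => hpos _ (hptm z), ?_, ?_, ?_, hVval, ?_, ?_⟩
  · intro θ
    apply hbd
    left
    rw [hcle _ (left_mem_Icc.2 hR.le)]
    exact norm_pt e he he0 hR₀ θ
  · intro r hr θ
    have h := deriv_r hR₀ hR hC e he he0 hr θ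
    simp only [hcle r (Ioo_subset_Icc_self hr)]
    refine h.congr_of_eventuallyEq ?_
    filter_upwards [isOpen_Ioo.mem_nhds hr] with s hs
    rw [hcle s (Ioo_subset_Icc_self hs)]
  · intro r θ
    exact deriv_th hR₀ hR hC e he he0 (hclm r) θ
  · intro x hx hθ
    have hx' : ‖x‖ ∈ Icc R₀ R₁ := ⟨hx.1.le, hx.2.le⟩
    have hx0 : 0 < ‖x‖ := hR₀.trans hx.1
    have hθ2 : angleOf x ∈ Ioo (-(π/2)) (π/2) :=
      ⟨by linarith [hθ.1, pi_pos], by linarith [hθ.2, pi_pos]⟩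
    obtain ⟨e', he', he0', hxe⟩ := decomp x hx0 hθ2
    simp only
    rw [← hVval x hx, hcle _ hx']
    set r := ‖x‖ with hr
    set θ := angleOf x with hθd
    have hP : fderivWithin ℝ u A (r • dir e θ) (dir e θ) = fderivWithin ℝ u A x (dir e' θ) := by
      have h1 := deriv_r hR₀ hR hC e he he0 hx θ
      have h2 := deriv_r hR₀ hR hC e' he' he0' hx θ
      rw [← hxe] at h2
      refine h1.unique (h2.congr_of_eventuallyEq ?_)
      filter_upwards [isOpen_Ioo.mem_nhds hx] with s hs
      rw [hval e he he0 s (Ioo_subset_Icc_self hs) θ (hang x),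
        hval e' he' he0' s (Ioo_subset_Icc_self hs) θ (hang x)]
    have hQ : fderivWithin ℝ u A (r • dir e θ) (r • dir' e θ) =
        fderivWithin ℝ u A x (r • dir' e' θ) := by
      have h1 := deriv_th hR₀ hR hC e he he0 hx' θ
      have h2 := deriv_th hR₀ hR hC e' he' he0' hx' θ
      rw [← hxe] at h2
      refine h1.unique (h2.congr_of_eventuallyEq ?_)
      filter_upwards [isOpen_Ioo.mem_nhds hθ2] with s hs
      rw [hval e he he0 r hx' s (Ioo_subset_Icc_self hs),
        hval e' he' he0' r hx' s (Ioo_subset_Icc_self hs)]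
    rw [hP, hQ]
    set L := fderivWithin ℝ u A x with hL
    have b1 : (L (dir e' θ))^2 ≤ ‖L‖^2 := by
      have := L.le_opNorm (dir e' θ)
      rw [norm_dir e' he' he0', mul_one, Real.norm_eq_abs] at this
      rw [← sq_abs]
      exact pow_le_pow_left₀ (abs_nonneg _) this 2
    have b2 : (L (r • dir' e' θ))^2 ≤ R₁^2 * ‖L‖^2 := by
      have := L.le_opNorm (r • dir' e' θ)
      rw [norm_smul, norm_dir' e' he' he0', mul_one, Real.norm_eq_abs, Real.norm_eq_abs,
        abs_of_pos hx0] at this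
      have h3 : |L (r • dir' e' θ)| ≤ R₁ * ‖L‖ :=
        this.trans (by rw [mul_comm]; exact mul_le_mul_of_nonneg_right hx'.2 (norm_nonneg _))
      rw [← sq_abs, ← mul_pow]
      exact pow_le_pow_left₀ (abs_nonneg _) h3 2
    nlinarith [sq_nonneg (u x), sq_nonneg ‖L‖, mul_nonneg (sq_nonneg R₁) (sq_nonneg (u x))]
  · intro r hr θ hθ
    simp only
    have hab : |θ| ≤ π/2 := abs_le.2 hθ
    have h0 := abs_nonneg θ
    rw [hcle r hr, hval e he he0 r hr θ hθ, hval e he he0 r hr (|θ|/2)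
      ⟨by linarith, by linarith⟩]
    have : 𝔲 r θ = 𝔲 r |θ| := by
      rcases abs_choice θ with h | h
      · rw [h]
      · rw [h, heven r hr θ hθ]
    rw [this]
    exact hanti r hr ⟨by linarith, by linarith⟩ ⟨h0, hab⟩ (by linarith)

lemma even4 (f : ℝ → ℝ) (hf : Continuous f) :
    ∫ θ in Icc (-(π/2)) (π/2), f (|θ|/2) = 4 * ∫ θ in Icc 0 (π/4), f θ := by
  have hp := pi_pos
  rw [integral_Icc_eq_integral_Ioc, integral_Icc_eq_integral_Ioc,
    ← intervalIntegral.integral_of_le (by linarith), ← intervalIntegral.integral_of_le (by linarith)]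
  have hc : Continuous fun θ : ℝ => f (|θ|/2) := by fun_prop
  rw [← intervalIntegral.integral_add_adjacent_intervals (b := 0) (hc.intervalIntegrable _ _)
    (hc.intervalIntegrable _ _)]
  have h1 : ∫ θ in (0:ℝ)..(π/2), f (|θ|/2) = 2 * ∫ θ in (0:ℝ)..(π/4), f θ := by
    have : ∫ θ in (0:ℝ)..(π/2), f (|θ|/2) = ∫ θ in (0:ℝ)..(π/2), f (θ/2) := by
      apply intervalIntegral.integral_congr
      intro θ hθ
      rw [uIcc_of_le (by linarith)] at hθ
      simp only [abs_of_nonneg hθ.1]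
    rw [this, intervalIntegral.integral_comp_div f two_ne_zero, smul_eq_mul, zero_div]
    congr 2
    ring
  have h2 : ∫ θ in (-(π/2))..0, f (|θ|/2) = ∫ θ in (0:ℝ)..(π/2), f (|θ|/2) := by
    have := intervalIntegral.integral_comp_neg (a := 0) (b := π/2) (fun θ : ℝ => f (|θ|/2))
    simp only [abs_neg, neg_zero] at this
    exact this.symm
  rw [h2, h1]; ring

lemma doubling {a b : ℝ} (V : ℝ × ℝ → ℝ) (hVc : Continuous V) (hV : ∀ z, 0 ≤ V z)
    (h : ∀ r ∈ Icc a b, ∀ θ ∈ Icc (-(π/2)) (π/2), V (r, θ) ≤ V (r, |θ|/2)) (j : ℕ) :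
    ∫ z in Icc a b ×ˢ Icc (-(π/2)) (π/2), V z ^ j ≤ 4 * ∫ z in Icc a b ×ˢ Icc 0 (π/4), V z ^ j := by
  have hc : Continuous fun z => V z ^ j := hVc.pow j
  have e1 := setIntegral_prod (μ := volume) (ν := volume) (fun z => V z ^ j) (s := Icc a b)
    (t := Icc (-(π/2)) (π/2))
    (hc.continuousOn.integrableOn_compact (isCompact_Icc.prod isCompact_Icc))
  have e2 := setIntegral_prod (μ := volume) (ν := volume) (fun z => V z ^ j) (s := Icc a b)
    (t := Icc 0 (π/4))
    (hc.continuousOn.integrableOn_compact (isCompact_Icc.prod isCompact_Icc))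
  have intg : ∀ s t : ℝ,
      IntegrableOn (fun r => ∫ θ in Icc s t, V (r, θ) ^ j) (Icc a b) := by
    intro s t
    have h : Integrable (fun z => V z ^ j) ((volume.restrict (Icc a b)).prod
        (volume.restrict (Icc s t))) := by
      rw [Measure.prod_restrict]
      exact hc.continuousOn.integrableOn_compact (isCompact_Icc.prod isCompact_Icc)
    exact h.integral_prod_left
  rw [Measure.volume_eq_prod, e1, e2, ← integral_const_mul]
  refine setIntegral_mono_on (intg _ _) ((intg _ _).const_mul _) measurableSet_Icc ?_
  intro r hr
  rw [← even4 (fun θ => V (r, θ) ^ j) (by fun_prop)]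
  refine setIntegral_mono_on
    ((by fun_prop : Continuous fun θ => V (r, θ) ^ j).continuousOn.integrableOn_compact isCompact_Icc)
    ((by fun_prop : Continuous fun θ : ℝ => V (r, |θ|/2) ^ j).continuousOn.integrableOn_compact isCompact_Icc)
    measurableSet_Icc ?_
  intro θ hθ
  exact pow_le_pow_left₀ (hV _) (h r hr θ hθ) j

lemma measurable_angleOf (n : ℕ) : Measurable fun x : EuclideanSpace ℝ (Fin (n+1)) => angleOf x := by
  simp only [angleOf, lastCoord_eq]
  fun_prop

lemma integrableOn_A {N : ℕ} {R₀ R₁ : ℝ} (hR₀ : 0 < R₀) (hR : R₀ < R₁)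
    {f : EuclideanSpace ℝ (Fin N) → ℝ} (hf : ContinuousOn f (closure (annulus N R₀ R₁))) :
    IntegrableOn f (annulus N R₀ R₁) :=
  (hf.integrableOn_compact (isCompact_annulus hR₀ hR)).mono_set subset_closure

lemma integrableOn_H {N : ℕ} {R₀ R₁ : ℝ} (hR₀ : 0 < R₀) (hR : R₀ < R₁)
    {u : EuclideanSpace ℝ (Fin N) → ℝ} (hu : memK N R₀ R₁ u) :
    IntegrableOn (fun x => ‖fderivWithin ℝ u (closure (annulus N R₀ R₁)) x‖ ^ 2 + (u x) ^ 2)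
      (annulus N R₀ R₁) :=
  integrableOn_A hR₀ hR
    ((((hu.1.1.continuousOn_fderivWithin (uniqueDiff_annulus hR₀ hR) le_rfl).norm.pow 2)).add
      (hu.1.1.continuousOn.pow 2))

lemma lower_bound {n : ℕ} (hn : 2 ≤ n) {R₀ R₁ : ℝ} (hR₀ : 0 < R₀) (hR : R₀ < R₁)
    (σ : ℝ) (hσ : 0 ≤ σ) (hσe : (volume : Measure (EuclideanSpace ℝ (Fin n))).toSphere univ = ENNReal.ofReal σ)
    (G : ℝ × ℝ → ℝ) (hGc : Continuous G) (hG : ∀ z, 0 ≤ G z)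
    (h : EuclideanSpace ℝ (Fin (n+1)) → ℝ) (hh : IntegrableOn h (annulus (n+1) R₀ R₁))
    (hh0 : ∀ x, 0 ≤ h x)
    (hb : ∀ x ∈ annulus (n+1) R₀ R₁, angleOf x ∈ Ioo 0 (π/4) → G (‖x‖, angleOf x) ≤ h x) :
    σ * (R₀^n * cos (π/4) ^ (n-1)) * ∫ z in Icc R₀ R₁ ×ˢ Icc 0 (π/4), G z ≤
      ∫ x in annulus (n+1) R₀ R₁, h x := by
  have hp := pi_pos
  set D' := Ioo R₀ R₁ ×ˢ Ioo 0 (π/4) with hD'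
  have hD'm : MeasurableSet D' := measurableSet_Ioo.prod measurableSet_Ioo
  set w := R₀^n * cos (π/4) ^ (n-1) with hw
  have hcos : 0 < cos (π/4) := by rw [cos_pi_div_four]; positivity
  have hw0 : 0 ≤ w := by positivity
  have hae : (Icc R₀ R₁ ×ˢ Icc 0 (π/4) : Set (ℝ × ℝ)) =ᵐ[volume] D' := by
    rw [Measure.volume_eq_prod]
    exact Measure.set_prod_ae_eq Ioo_ae_eq_Icc.symm Ioo_ae_eq_Icc.symm
  rw [setIntegral_congr_set hae]
  have hGi : IntegrableOn G D' := (hGc.continuousOn.integrableOn_compact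
    (isCompact_Icc.prod isCompact_Icc)).mono_set
      (prod_mono (Ioo_subset_Icc_self (a := R₀) (b := R₁)) (Ioo_subset_Icc_self (a := 0) (b := π/4)))
  have hI0 : 0 ≤ ∫ x in annulus (n+1) R₀ R₁, h x := integral_nonneg hh0
  rw [← ENNReal.ofReal_le_ofReal_iff hI0, ENNReal.ofReal_mul (by positivity),
    ENNReal.ofReal_mul hσ, ← hσe,
    ofReal_integral_eq_lintegral_ofReal hGi (Filter.Eventually.of_forall hG),
    ofReal_integral_eq_lintegral_ofReal hh (Filter.Eventually.of_forall hh0)]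
  have hF : Measurable (D'.indicator fun z => ENNReal.ofReal (G z)) :=
    Measurable.indicator (by fun_prop) hD'm
  have hpol := lintegral_polar n hn _ hF
  have h1 : ∫⁻ x : EuclideanSpace ℝ (Fin (n+1)),
      (D'.indicator fun z => ENNReal.ofReal (G z)) (‖x‖, angleOf x) ≤
      ∫⁻ x in annulus (n+1) R₀ R₁, ENNReal.ofReal (h x) := by
    rw [← lintegral_indicator isOpen_annulus.measurableSet]
    apply lintegral_mono
    intro x
    by_cases hx : (‖x‖, angleOf x) ∈ D'
    · have hxA : x ∈ annulus (n+1) R₀ R₁ := hx.1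
      simp only [indicator_of_mem hx, indicator_of_mem hxA]
      exact ENNReal.ofReal_le_ofReal (hb x hxA hx.2)
    · simp [indicator_of_notMem hx]
  refine le_trans ?_ h1
  rw [hpol, mul_assoc]
  gcongr
  rw [← lintegral_const_mul' _ _ ENNReal.ofReal_ne_top, ← lintegral_indicator hD'm,
    ← lintegral_indicator (measurableSet_Ioi.prod measurableSet_Ioo)]
  apply lintegral_mono
  rintro ⟨r, θ⟩
  by_cases hz : (r, θ) ∈ D'
  · have hz2 : (r, θ) ∈ Ioi (0:ℝ) ×ˢ Ioo (-(π/2)) (π/2) :=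
      ⟨hR₀.trans hz.1.1, by linarith [hz.2.1], by linarith [hz.2.2]⟩
    simp only [indicator_of_mem hz, indicator_of_mem hz2]
    gcongr
    rw [hw, wt]
    have h3 : cos (π/4) ≤ cos θ :=
      cos_le_cos_of_nonneg_of_le_pi hz.2.1.le (by linarith) hz.2.2.le
    have h4 : R₀ ≤ r := hz.1.1.le
    have h5 : 0 ≤ r := hR₀.le.trans h4
    simp only
    gcongr
  · simp [indicator_of_notMem hz]

lemma upper_bound {n : ℕ} (hn : 2 ≤ n) {R₀ R₁ : ℝ} (hR₀ : 0 < R₀) (hR : R₀ < R₁)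
    (σ : ℝ) (hσ : 0 ≤ σ) (hσe : (volume : Measure (EuclideanSpace ℝ (Fin n))).toSphere univ = ENNReal.ofReal σ)
    (G : ℝ × ℝ → ℝ) (hGc : Continuous G) (hG : ∀ z, 0 ≤ G z)
    (h : EuclideanSpace ℝ (Fin (n+1)) → ℝ) (hh : IntegrableOn h (annulus (n+1) R₀ R₁))
    (hb : ∀ x ∈ annulus (n+1) R₀ R₁, h x = G (‖x‖, angleOf x)) :
    ∫ x in annulus (n+1) R₀ R₁, h x ≤
     σ * R₁^n * ∫ z in Icc R₀ R₁ ×ˢ Icc (-(π/2)) (π/2), G z := by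
  have hR1 := hR₀.trans hR
  have hGi : IntegrableOn G (Icc R₀ R₁ ×ˢ Icc (-(π/2)) (π/2)) :=
    hGc.continuousOn.integrableOn_compact (isCompact_Icc.prod isCompact_Icc)
  have hI0 : 0 ≤ ∫ z in Icc R₀ R₁ ×ˢ Icc (-(π/2)) (π/2), G z := integral_nonneg hG
  have hAm : MeasurableSet (annulus (n+1) R₀ R₁) := isOpen_annulus.measurableSet
  have hh0 : 0 ≤ᵐ[volume.restrict (annulus (n+1) R₀ R₁)] h := by
    filter_upwards [ae_restrict_mem hAm] with x hx
    rw [hb x hx]; exact hG _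
  rw [← ENNReal.ofReal_le_ofReal_iff (by positivity), ENNReal.ofReal_mul (by positivity),
    ENNReal.ofReal_mul hσ, ← hσe,
    ofReal_integral_eq_lintegral_ofReal hGi (Filter.Eventually.of_forall hG),
    ofReal_integral_eq_lintegral_ofReal hh hh0]
  set B : Set (ℝ × ℝ) := Ioo R₀ R₁ ×ˢ univ with hB
  have hBm : MeasurableSet B := measurableSet_Ioo.prod MeasurableSet.univ
  have hF : Measurable (B.indicator fun z => ENNReal.ofReal (G z)) :=
    Measurable.indicator (by fun_prop) hBm
  have hpol := lintegral_polar n hn _ hF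
  have h1 : ∫⁻ x in annulus (n+1) R₀ R₁, ENNReal.ofReal (h x) =
      ∫⁻ x : EuclideanSpace ℝ (Fin (n+1)),
      (B.indicator fun z => ENNReal.ofReal (G z)) (‖x‖, angleOf x) := by
    rw [← lintegral_indicator hAm]
    congr 1
    ext x
    by_cases hx : x ∈ annulus (n+1) R₀ R₁
    · have hxA : (‖x‖, angleOf x) ∈ B := ⟨hx, mem_univ _⟩
      rw [indicator_of_mem hx, indicator_of_mem hxA, hb x hx]
    · have hxA : (‖x‖, angleOf x) ∉ B := fun h' => hx h'.1
      rw [indicator_of_notMem hx, indicator_of_notMem hxA]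
  rw [h1, hpol, mul_assoc]
  gcongr
  rw [← lintegral_const_mul' _ _ ENNReal.ofReal_ne_top,
    ← lintegral_indicator (measurableSet_Icc.prod measurableSet_Icc),
    ← lintegral_indicator (measurableSet_Ioi.prod measurableSet_Ioo)]
  apply lintegral_mono
  rintro ⟨r, θ⟩
  by_cases hz : (r, θ) ∈ Ioi (0:ℝ) ×ˢ Ioo (-(π/2)) (π/2)
  · rw [indicator_of_mem hz]
    by_cases hz2 : (r, θ) ∈ B
    · have hz3 : (r, θ) ∈ Icc R₀ R₁ ×ˢ Icc (-(π/2)) (π/2) :=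
        ⟨Ioo_subset_Icc_self hz2.1, Ioo_subset_Icc_self hz.2⟩
      rw [indicator_of_mem hz2, indicator_of_mem hz3]
      gcongr
      rw [wt]
      have h3 : (cos θ)^(n-1) ≤ 1 := pow_le_one₀ (cos_pos_of_mem_Ioo hz.2).le (cos_le_one θ)
      have h5 : r^n ≤ R₁^n := pow_le_pow_left₀ (hR₀.trans hz2.1.1).le hz2.1.2.le n
      have h6 : 0 ≤ r^n := pow_nonneg (hR₀.trans hz2.1.1).le n
      calc r^n * (cos θ)^(n-1) ≤ r^n * 1 := mul_le_mul_of_nonneg_left h3 h6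
        _ ≤ _ := by simpa using h5
    · rw [indicator_of_notMem hz2]; simp
  · rw [indicator_of_notMem hz]; simp

lemma key_ineq {n : ℕ} (hn : 2 ≤ n) {R₀ R₁ : ℝ} (hR₀ : 0 < R₀) (hR : R₀ < R₁) (k : ℕ) :
    ∃ C : ℝ, 0 ≤ C ∧ ∀ u, memK (n+1) R₀ R₁ u →
      ∫ x in annulus (n+1) R₀ R₁, u x ^ (2 * (k+1)) ≤ C * H1sq (n+1) R₀ R₁ u ^ (k+1) := by
  have hp := pi_pos
  obtain ⟨C, hC, hS⟩ := sob2D (π/4) (by linarith) k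
  have : Nonempty (Fin n) := ⟨⟨0, by omega⟩⟩
  set σe := (volume : Measure (EuclideanSpace ℝ (Fin n))).toSphere univ with hσe
  have hσt : σe ≠ ⊤ := measure_ne_top _ _
  have hσ0 : σe ≠ 0 := by
    rw [hσe, Measure.toSphere_apply_univ]
    refine mul_ne_zero ?_ (Metric.measure_ball_pos _ _ one_pos).ne'
    simp; omega
  set σ := σe.toReal with hσ
  have hσpos : 0 < σ := ENNReal.toReal_pos hσ0 hσt
  have hσeq : σe = ENNReal.ofReal σ := (ENNReal.ofReal_toReal hσt).symm
  have hcos : 0 < cos (π/4) := by rw [cos_pi_div_four]; positivity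
  have hR1 := hR₀.trans hR
  set w := σ * (R₀^n * cos (π/4) ^ (n-1)) with hw
  have hwpos : 0 < w := by positivity
  refine ⟨σ * R₁^n * (4 * (C * ((2 + R₁^2)/w)^(k+1))), by positivity, ?_⟩
  intro u hu
  obtain ⟨V, P, Q, hVc, hPc, hQc, hV, hV0, hP, hQ, hval, hlow, hdbl⟩ := exists_VPQ hn hR₀ hR hu
  have s1 := hS R₀ R₁ hR V P Q hVc hPc hQc hV hV0 hP hQ
  have s2 := doubling (a := R₀) (b := R₁) V hVc hV hdbl (2*(k+1))
  have s3 := upper_bound hn hR₀ hR σ hσpos.le hσeq (fun z => V z ^ (2*(k+1))) (by fun_prop)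
    (fun z => pow_nonneg (hV z) _) (fun x => u x ^ (2*(k+1)))
    (integrableOn_A hR₀ hR (hu.1.1.continuousOn.pow _)) (fun x hx => by simp only [hval x hx])
  have s4 := lower_bound hn hR₀ hR σ hσpos.le hσeq (fun z => V z ^ 2 + P z ^ 2 + Q z ^ 2)
    (by fun_prop) (fun z => by positivity) _ ((integrableOn_H hR₀ hR hu).const_mul (2 + R₁^2))
    (fun x => by positivity) hlow
  rw [integral_const_mul] at s4
  change w * _ ≤ (2 + R₁^2) * H1sq (n+1) R₀ R₁ u at s4
  set S := ∫ z in Icc R₀ R₁ ×ˢ Icc 0 (π/4), (V z ^ 2 + P z ^ 2 + Q z ^ 2) with hSdef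
  set H := H1sq (n+1) R₀ R₁ u with hH
  have S0 : 0 ≤ S := integral_nonneg fun z => by positivity
  have s5 : S ≤ (2 + R₁^2)/w * H := by
    rw [div_mul_eq_mul_div, le_div_iff₀ hwpos]; linarith
  calc _ ≤ _ := s3
    _ ≤ σ * R₁^n * (4 * (C * ((2 + R₁^2)/w * H)^(k+1))) := by
      gcongr
      refine s2.trans ?_
      gcongr
      refine s1.trans ?_
      gcongr
    _ = _ := by rw [mul_pow]; ring

lemma rpow_split {p ε : ℝ} (hp : 2 < p) (hε : 0 < ε) (m : ℕ) (hm : p ≤ 2 * m) :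
    ∃ B : ℝ, 0 ≤ B ∧ ∀ t : ℝ, 0 ≤ t → t ^ p ≤ ε * t^2 + B * t^(2*m) := by
  set δ := ε ^ (1/(p-2)) with hδ
  have hδ0 : 0 < δ := rpow_pos_of_pos hε _
  have hδp : δ ^ (p-2) = ε := by
    rw [hδ, ← rpow_mul hε.le, one_div_mul_cancel (by linarith), rpow_one]
  refine ⟨δ ^ (p - 2*m), by positivity, ?_⟩
  intro t ht
  have e1 : 0 ≤ ε * t^2 := by positivity
  have e2 : 0 ≤ δ ^ (p - 2*m) * t^(2*m) := by positivity
  rcases ht.eq_or_lt with h0 | h0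
  · rw [← h0, zero_rpow (by linarith)]; rw [← h0] at e1 e2; linarith
  rcases le_total t δ with h | h
  · have : t ^ p = t^(p-2) * t^2 := by
      rw [← rpow_natCast t 2, ← rpow_add h0]; simp
    have h2 : t^(p-2) ≤ ε := by
      rw [← hδp]; exact rpow_le_rpow ht h (by linarith)
    have : t ^ p ≤ ε * t^2 := by rw [this]; gcongr
    linarith
  · have : t ^ p = t^(p-2*m) * t^(2*m) := by
      rw [← rpow_natCast t (2*m), ← rpow_add h0]; simp
    have h2 : t^(p-2*m) ≤ δ ^ (p - 2*m) :=
      rpow_le_rpow_of_nonpos hδ0 h (by linarith)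
    have : t ^ p ≤ δ ^ (p - 2*m) * t^(2*m) := by rw [this]; gcongr
    linarith

/-- mountain pass geometry of `I` on the cone `K`. -/
theorem statement10 (N : ℕ) (hN : 3 ≤ N) (R₀ R₁ : ℝ) (hR₀ : 0 < R₀) (hR : R₀ < R₁)
    (p : ℝ) (hp : 2 < p) (a : EuclideanSpace ℝ (Fin N) → ℝ)
    (ha : memKhat N R₀ R₁ a) (hapos : ∀ x ∈ closure (annulus N R₀ R₁), 0 < a x) :
    ∃ α : ℝ, 0 < α ∧ ∃ ρ : ℝ, 0 < ρ ∧
      (∀ u, memK N R₀ R₁ u → Real.sqrt (H1sq N R₀ R₁ u) < α →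
        0 ≤ funcI N R₀ R₁ a p u) ∧
      (∀ u, memK N R₀ R₁ u → Real.sqrt (H1sq N R₀ R₁ u) = α →
        ρ ≤ funcI N R₀ R₁ a p u) := by
  obtain ⟨n, rfl⟩ : ∃ n, N = n + 1 := ⟨N - 1, by omega⟩
  have hn : 2 ≤ n := by omega
  obtain ⟨k0, hk0⟩ := exists_nat_ge p
  obtain ⟨k, hk1, hk⟩ : ∃ k : ℕ, 1 ≤ k ∧ p ≤ 2 * ((k+1 : ℕ) : ℝ) :=
    ⟨k0 + 1, by omega, by push_cast; have : (0:ℝ) ≤ k0 := by positivity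
                          linarith⟩
  obtain ⟨C, hC, hkey⟩ := key_ineq hn hR₀ hR k
  obtain ⟨M0, hM0⟩ := (isCompact_annulus (N := n+1) hR₀ hR).exists_bound_of_continuousOn
    ha.1.continuousOn
  set M := max M0 1 with hM
  have hM1 : 0 < M := lt_of_lt_of_le one_pos (le_max_right _ _)
  have hMb : ∀ x ∈ closure (annulus (n+1) R₀ R₁), a x ≤ M := fun x hx =>
    (le_abs_self _).trans ((hM0 x hx).trans (le_max_left _ _))
  obtain ⟨B, hB, hsplit⟩ := rpow_split (ε := 1 / (4 * M)) hp (by positivity) (k+1) hk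
  set C' := M * B * C with hC'
  have hC'0 : 0 ≤ C' := by positivity
  -- main estimate
  have main : ∀ u, memK (n+1) R₀ R₁ u → 0 ≤ H1sq (n+1) R₀ R₁ u ∧
      H1sq (n+1) R₀ R₁ u * (1/4) - C' * H1sq (n+1) R₀ R₁ u ^ (k+1) ≤ funcI (n+1) R₀ R₁ a p u := by
    intro u hu
    have hH0 : 0 ≤ H1sq (n+1) R₀ R₁ u := integral_nonneg fun x => by positivity
    refine ⟨hH0, ?_⟩
    have hk2 := hkey u hu
    have huc := hu.1.1.continuousOn
    have i2 : IntegrableOn (fun x => u x ^ 2) (annulus (n+1) R₀ R₁) :=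
      integrableOn_A hR₀ hR (huc.pow 2)
    have i2m : IntegrableOn (fun x => u x ^ (2*(k+1))) (annulus (n+1) R₀ R₁) :=
      integrableOn_A hR₀ hR (huc.pow _)
    have ip : IntegrableOn (fun x => a x * |u x| ^ p) (annulus (n+1) R₀ R₁) :=
      integrableOn_A hR₀ hR (ha.1.continuousOn.mul
        (huc.abs.rpow_const fun x _ => Or.inr (by linarith)))
    have hAm : MeasurableSet (annulus (n+1) R₀ R₁) := isOpen_annulus.measurableSet
    have h2 : ∫ x in annulus (n+1) R₀ R₁, u x ^ 2 ≤ H1sq (n+1) R₀ R₁ u :=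
      setIntegral_mono i2 (integrableOn_H hR₀ hR hu) fun x => by
        simp only [le_add_iff_nonneg_left]; positivity
    have h3 : ∫ x in annulus (n+1) R₀ R₁, a x * |u x| ^ p ≤
        ∫ x in annulus (n+1) R₀ R₁, ((1/4) * u x ^ 2 + (M * B) * u x ^ (2*(k+1))) := by
      refine setIntegral_mono_on ip ((i2.const_mul _).add (i2m.const_mul _)) hAm ?_
      intro x hx
      have hxc := subset_closure hx
      have hu0 : 0 ≤ u x := hu.1.2.1 x hxc
      rw [abs_of_nonneg hu0]
      calc a x * u x ^ p ≤ M * u x ^ p := by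
            gcongr
            exact hMb x hxc
        _ ≤ M * (1 / (4 * M) * u x^2 + B * u x^(2*(k+1))) := by
            gcongr
            exact hsplit _ hu0
        _ = _ := by field_simp
    rw [integral_add (i2.const_mul _) (i2m.const_mul _), integral_const_mul,
      integral_const_mul] at h3
    have h4 : ∫ x in annulus (n+1) R₀ R₁, a x * |u x| ^ p ≤
        (1/4) * H1sq (n+1) R₀ R₁ u + C' * H1sq (n+1) R₀ R₁ u ^ (k+1) := by
      refine h3.trans (add_le_add (by linarith) ?_)
      rw [hC', mul_assoc (M * B)]
      gcongr
    have h5 : 0 ≤ ∫ x in annulus (n+1) R₀ R₁, a x * |u x| ^ p :=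
      setIntegral_nonneg hAm fun x hx =>
        mul_nonneg (hapos x (subset_closure hx)).le (by positivity)
    have h6 : (1/p) * ∫ x in annulus (n+1) R₀ R₁, a x * |u x| ^ p ≤
        ∫ x in annulus (n+1) R₀ R₁, a x * |u x| ^ p := by
      have : 1/p ≤ 1 := by rw [div_le_one (by linarith)]; linarith
      exact mul_le_of_le_one_left h5 this
    rw [funcI]
    linarith
  set α2 := min 1 (1 / (8 * (C' + 1))) with hα2
  have hα2pos : 0 < α2 := by positivity
  have key2 : ∀ u, memK (n+1) R₀ R₁ u → H1sq (n+1) R₀ R₁ u ≤ α2 →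
      H1sq (n+1) R₀ R₁ u * (1/8) ≤ funcI (n+1) R₀ R₁ a p u := by
    intro u hu hle
    obtain ⟨hH0, hI⟩ := main u hu
    set H := H1sq (n+1) R₀ R₁ u
    have h1 : H ≤ 1 := hle.trans (min_le_left _ _)
    have h2 : H ≤ 1 / (8 * (C' + 1)) := hle.trans (min_le_right _ _)
    have h3 : H ^ (k+1) ≤ H^2 := pow_le_pow_of_le_one hH0 h1 (by omega)
    have h4 : C' * H ≤ 1/8 := by
      rw [le_div_iff₀ (by positivity)] at h2
      nlinarith
    have h5 : C' * H ^ (k+1) ≤ H * (1/8) := by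
      calc C' * H ^ (k+1) ≤ C' * H^2 := by gcongr
        _ = H * (C' * H) := by ring
        _ ≤ _ := by gcongr
    linarith
  refine ⟨√α2, Real.sqrt_pos.2 hα2pos, α2 * (1/8), by positivity, ?_, ?_⟩
  · intro u hu hlt
    have hH0 := (main u hu).1
    have := key2 u hu ((Real.sqrt_lt_sqrt_iff hH0).1 hlt).le
    linarith
  · intro u hu heq
    have hH0 := (main u hu).1
    have h1 := (Real.sqrt_inj hH0 hα2pos.le).1 heq
    have := key2 u hu h1.le
    rwa [h1] at this
end
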